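/- arXiv:0812.3385 — 5 statements merged into one kernel-verified Lean document; each statement's English description precedes it below -/
import Mathlib

section
/- Let p, q, r be positive real numbers. Let (y_n)_{n≥-1} be any sequence of positive reals with y_{-1}, y_0 ∈ (0,∞) satisfying y_{n+1} = (r + p·y_n + y_{n-1})/(q·y_n + y_{n-1}) for all n ≥ 0. Then either y_n converges to the unique positive equilibrium ȳ = (p+1+√((p+1)² + 4r(q+1)))/(2(q+1)), or there exists a pair (φ, ψ) of distinct positive reals with φ = (r + p·ψ + φ)/(q·ψ + φ) and ψ = (r + p·φ + ψ)/(q·φ + ψ) such that the even-indexed terms converge to one of φ, ψ and the odd-indexed terms converge to the other. -/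
open Filter Topology Set

/-- Numerator of the rational Lyapunov function on pairs of consecutive terms. -/
noncomputable def lyapNum (p q r x z : ℝ) : ℝ :=
  (2 - q) * (-q * x ^ 2 * z ^ 2 + 2 * p * x * z * (x + z)
    + (2 * p ^ 2 - p - q * r) * (x ^ 2 + z ^ 2))
  + 2 * (p * (2 * p ^ 2 - p - q * r) + 2 * p * r) * (x + z)
  + (2 - q) * r * (2 * p ^ 2 - p - q * r) - (p * (2 * p ^ 2 - p - q * r) + 2 * p * r)

/-- Denominator of the rational Lyapunov function on pairs of consecutive terms. -/
noncomputable def lyapDen (p q r x z : ℝ) : ℝ :=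
  (2 - q) * (x * z + q / 2 * (x ^ 2 + z ^ 2)) + (p * q - 1) * (x + z)
    + (2 - q) * r * q / 2 - (p * q - 1) / 2

/-- The drop of `lyapNum / lyapDen` along one step of the recurrence, cleared of denominators. -/
lemma lyap_cross (p q r x z w : ℝ) (hw : w * (q * x + z) = r + p * x + z) :
    lyapNum p q r x z * lyapDen p q r w x - lyapNum p q r w x * lyapDen p q r x z =
      (2 - q) * ((2 - q) * x + 2 * p - 1) * (-q * x ^ 2 + 2 * p * x - p - q * r)
        * ((1 + q * x) / 2) * (z - w) ^ 2 := by
  have h : z * w + (q * x - 1) / 2 * (z + w) - (r + p * x) = (1 + q * x) / 2 * (z - w) := by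
    linear_combination hw
  calc _ = (2 - q) * ((2 - q) * x + 2 * p - 1) * (-q * x ^ 2 + 2 * p * x - p - q * r)
        * (z - w) * (z * w + (q * x - 1) / 2 * (z + w) - (r + p * x)) := by
        unfold lyapNum lyapDen; ring
    _ = _ := by rw [h]; ring

lemma lyapDen_pos {p q r x z : ℝ} (hp : 0 < p) (hq : 0 < q) (hq1 : q < 1) (hr : 0 < r)
    (hx : 1 ≤ x) (hz : 1 ≤ z) : 0 < lyapDen p q r x z := by
  have e : lyapDen p q r x z = (2 - q) * ((x - 1) * (z - 1) + q / 2 * ((x - 1) ^ 2 + (z - 1) ^ 2))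
      + ((2 - q) * (1 + q) - 1 + p * q) * ((x - 1) + (z - 1))
      + ((2 - q) * (1 + q) - 3 / 2 + 3 / 2 * (p * q)) + (2 - q) * r * q / 2 := by
    unfold lyapDen; ring
  have h2 : 0 < 2 - q := by linarith
  have h3 : 0 < (2 - q) * (1 + q) - 3 / 2 := by nlinarith
  have hx' : 0 ≤ x - 1 := by linarith
  have hz' : 0 ≤ z - 1 := by linarith
  have h4 : 0 ≤ ((2 - q) * (1 + q) - 1 + p * q) * ((x - 1) + (z - 1)) := by
    apply mul_nonneg <;> nlinarith [mul_pos hp hq]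
  have h5 : 0 ≤ (2 - q) * ((x - 1) * (z - 1) + q / 2 * ((x - 1) ^ 2 + (z - 1) ^ 2)) := by
    positivity
  have h6 : 0 < (2 - q) * r * q / 2 := by positivity
  nlinarith [mul_pos hp hq]

/-- If `q ≤ p` and the limit inferior `I` and superior `S` differ, they lie in the region where the
Lyapunov function decreases. -/
lemma extremes_of_le_of_lt {p q r I S x z x' z' : ℝ} (hq : 0 < q) (hr : 0 < r) (hpq : q ≤ p)
    (hI : 0 < I) (hIS : I < S) (hx : x ∈ Icc I S) (hz : z ∈ Icc I S) (hx' : x' ∈ Icc I S)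
    (hz' : z' ∈ Icc I S) (hS : S * (q * x + z) = r + p * x + z)
    (hIe : I * (q * x' + z') = r + p * x' + z') :
    q < 1 ∧ 1 ≤ I ∧ 0 < -q * I ^ 2 + 2 * p * I - p - q * r ∧
      0 < -q * S ^ 2 + 2 * p * S - p - q * r ∧ q * S < p := by
  obtain ⟨hx1, hx2⟩ := hx
  obtain ⟨hz1, hz2⟩ := hz
  obtain ⟨hx1', hx2'⟩ := hx'
  obtain ⟨hz1', hz2'⟩ := hz'
  have hI1 : 1 ≤ I := by
    by_contra! h
    have h1 : 0 < (1 - I) * z' := mul_pos (by linarith) (by linarith)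
    have h2 : 0 ≤ (p - q * I) * x' := mul_nonneg (by nlinarith) (by linarith)
    nlinarith
  have hSx : (S - 1) * I ≤ r + (p - q * S) * x := by
    have := mul_le_mul_of_nonneg_left hz1 (by linarith : 0 ≤ S - 1)
    nlinarith
  have hIx : r + (p - q * I) * x' ≤ (I - 1) * S := by
    have := mul_le_mul_of_nonneg_left hz2' (by linarith : 0 ≤ I - 1)
    nlinarith
  have hB : q * r < (p - q) * S → r + (p - q * I) * I ≤ (I - 1) * S := by
    intro h
    rcases le_total (q * I) p with h1 | h1
    · have := mul_le_mul_of_nonneg_left hx1' (by linarith : 0 ≤ p - q * I)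
      linarith
    · have h2 : q * r ≤ q * ((I - 1) * S) := by
        have := mul_le_mul_of_nonneg_right (by linarith : p - q ≤ q * (I - 1)) (hI.trans hIS).le
        linarith
      have h3 := le_of_mul_le_mul_left h2 hq
      have h4 : 0 ≤ (q * I - p) * I := mul_nonneg (by linarith) hI.le
      linarith
  rcases lt_or_ge ((p - q) * I) (q * r) with hd | hd
  · exfalso
    have hA : (q + 1) * S * I ≤ r + (p + 1) * I := by
      rcases le_total p (q * S) with h1 | h1
      · have := mul_le_mul_of_nonneg_left hx1 (by linarith : 0 ≤ q * S - p)
        linarith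
      · have h2 : (q * S) * ((q + 1) * I) ≤ p * ((q + 1) * I) :=
          mul_le_mul_of_nonneg_right h1 (by positivity)
        have h3 : q * ((q + 1) * S * I) ≤ q * (r + (p + 1) * I) := by linarith
        exact le_of_mul_le_mul_left h3 hq
    rcases lt_or_ge (q * r) ((p - q) * S) with hdS | hdS
    · have h1 := hB hdS
      have h2 := mul_le_mul_of_nonneg_left h1 (by linarith : 0 ≤ q + 1)
      have h3 : q * (r + (p + 1) * I) < q * ((q + 1) * I * I) := by nlinarith
      have h4 := lt_of_mul_lt_mul_left h3 hq.le
      have h5 : (q + 1) * I * I < (q + 1) * S * I := by gcongr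
      linarith
    · have h1 : p ≤ q * I := by
        by_contra! h
        have h2 : 0 < (p - q * I) * x' := mul_pos (by linarith) (by linarith)
        have h3 : q * ((I - 1) * S) ≤ (p - q) * S := by
          have := mul_le_mul_of_nonneg_right (by linarith : q * (I - 1) ≤ p - q)
            (hI.trans hIS).le
          linarith
        have h4 : q * r < q * ((I - 1) * S) := by gcongr; linarith
        linarith
      have := mul_le_mul_of_nonneg_left hx2' (by linarith : 0 ≤ q * I - p)
      nlinarith
  · have hdp : 0 < p - q := by
      by_contra! h
      nlinarith [mul_pos hq hr]
    have hdS : q * r < (p - q) * S := lt_of_le_of_lt hd (by gcongr)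
    have h1 := hB hdS
    have h2 : (S - 1) * I ≤ r + (p - q * S) * S := by
      rcases le_or_gt (q * S) p with h | h
      · have := mul_le_mul_of_nonneg_left hx2 (by linarith : 0 ≤ p - q * S)
        linarith
      · exfalso
        have h3 : q * r ≤ q * ((S - 1) * I) := by
          have := mul_le_mul_of_nonneg_right (by linarith : p - q ≤ q * (S - 1)) hI.le
          linarith
        have h4 := le_of_mul_le_mul_left h3 hq
        have := mul_pos (by linarith : 0 < q * S - p) (by linarith : 0 < x)
        linarith
    have h3 : q * (S + I) ≤ p - 1 := by
      have : (S - I) * (q * (S + I)) ≤ (S - I) * (p - 1) := by linarith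
      exact le_of_mul_le_mul_left this (by linarith)
    have h4 : r + I + S ≤ (1 - q) * (S * I) := by
      have := mul_le_mul_of_nonneg_right h3 hI.le
      nlinarith
    have hSI : 0 < S * I := by nlinarith
    have hq1 : q < 1 := by
      by_contra! h
      have := mul_nonneg (by linarith : 0 ≤ q - 1) hSI.le
      linarith
    have hqI := mul_pos hq hI
    have hqS := mul_pos hq (hI.trans hIS)
    refine ⟨hq1, hI1, ?_, ?_, by linarith⟩
    · have h5 := mul_le_mul_of_nonneg_left h4 hq.le
      have h6 := mul_le_mul_of_nonneg_left h3 (mul_nonneg (sub_nonneg.2 hq1.le) hI.le)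
      have h7 : q * I * (q * (2 * I)) ≤ q * I * (p - 1) := by
        apply mul_le_mul_of_nonneg_left _ hqI.le
        have := mul_lt_mul_of_pos_left hIS hq
        linarith
      have h8 := mul_nonneg hqI.le (by linarith : 0 ≤ p - 1)
      have h9 := mul_nonneg (by linarith : 0 ≤ p) (sub_nonneg.2 hI1)
      linarith
    · have h5 := mul_le_mul_of_nonneg_left h4 (by linarith : 0 ≤ 1 + q)
      have h6 : 0 < q ^ 2 * (S * I) := mul_pos (pow_pos hq 2) hSI
      have h7 := mul_nonneg (by linarith : 0 ≤ p) (by linarith : 0 ≤ S - 1)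
      linarith

/-- If `p < q` and the limit inferior `I` and superior `S` differ, the recurrence function is
increasing in its older argument on `[I, S]`. -/
lemma increasing_region_of_lt {p q r I S x z x' z' : ℝ} (hp : 0 < p) (hpq : p < q) (hr : 0 < r)
    (hI : 0 < I) (hIS : I < S) (hx : x ∈ Icc I S) (hz : z ∈ Icc I S) (hx' : x' ∈ Icc I S)
    (hz' : z' ∈ Icc I S) (hS : S * (q * x + z) = r + p * x + z)
    (hIe : I * (q * x' + z') = r + p * x' + z') :
    r < (q - p) * I := by
  obtain ⟨hx1, hx2⟩ := hx
  obtain ⟨hz1, hz2⟩ := hz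
  obtain ⟨hx1', hx2'⟩ := hx'
  obtain ⟨hz1', hz2'⟩ := hz'
  by_contra! hd
  have hS0 := hI.trans hIS
  have hqI : p < q * I := by
    by_contra! h
    have h1 : 0 ≤ (p - q * I) * x' := mul_nonneg (by linarith) (by linarith)
    have h2 : 0 ≤ (1 - I) * z' := mul_nonneg (by nlinarith) (by linarith)
    nlinarith
  have hSx : (S - 1) * z ≤ r - (q * S - p) * I := by
    have := mul_le_mul_of_nonneg_left hx1 (by nlinarith : 0 ≤ q * S - p)
    nlinarith
  have hIx : r - (q * I - p) * S ≤ (I - 1) * z' := by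
    have := mul_le_mul_of_nonneg_left hx2' (by linarith : 0 ≤ q * I - p)
    nlinarith
  have hA : (q + 1) * S * I ≤ r + (p + 1) * I := by
    rcases le_total 1 S with h | h
    · have := mul_le_mul_of_nonneg_left hz1 (by linarith : 0 ≤ S - 1)
      linarith
    · have := mul_nonneg (by linarith : 0 ≤ 1 - S) hI.le
      have := mul_nonneg (mul_nonneg (by linarith : 0 ≤ 1 - S) hI.le) (by linarith : 0 ≤ q)
      linarith
  rcases le_or_gt ((q - p) * S) r with hdS | hdS
  · have hB : r + (p + 1) * S ≤ (q + 1) * S * I := by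
      rcases le_total 1 I with h | h
      · have := mul_le_mul_of_nonneg_left hz2' (by linarith : 0 ≤ I - 1)
        linarith
      · rcases h.eq_or_lt with h | h
        · subst h; linarith
        · exfalso
          have h1 := mul_pos (by linarith : 0 < 1 - I) (by linarith : 0 < z')
          have h2 := mul_nonneg (mul_nonneg (by linarith : 0 ≤ 1 - I) hS0.le)
            (by linarith : 0 ≤ q)
          linarith
    nlinarith
  · have hB : r - (q * I - p) * S ≤ (I - 1) * I := by
      rcases le_total I 1 with h | h
      · have := mul_le_mul_of_nonneg_left hz1' (by linarith : 0 ≤ 1 - I)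
        linarith
      · have h1 := mul_nonneg (by linarith : 0 ≤ I - 1) hI.le
        have h2 := mul_nonneg (mul_nonneg (by linarith : 0 ≤ I - 1) hS0.le)
            (by linarith : 0 ≤ q)
        linarith
    have h1 := mul_le_mul_of_nonneg_left hB (by linarith : 0 ≤ q + 1)
    have h2 := mul_le_mul_of_nonneg_left hA (by linarith : 0 ≤ q)
    have h3 : (q + 1) * p * I < (q + 1) * p * S :=
      mul_lt_mul_of_pos_left hIS (mul_pos (by linarith) hp)
    have h4 := mul_lt_mul_of_pos_left hIS (mul_pos (by linarith : 0 < q + 1) hI)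
    linarith

lemma exists_tendsto_triple {y : ℕ → ℝ} {L U w : ℝ} (hy : ∀ n, y n ∈ Icc L U)
    (hw : MapClusterPt w atTop y) :
    ∃ z x : ℝ, ∃ χ : ℕ → ℕ, Tendsto χ atTop atTop ∧ Tendsto (fun k => y (χ k)) atTop (𝓝 z) ∧
      Tendsto (fun k => y (χ k + 1)) atTop (𝓝 x) ∧
      Tendsto (fun k => y (χ k + 2)) atTop (𝓝 w) := by
  obtain ⟨ψ, hψ, hψw⟩ := MapClusterPt.tendsto_subseq hw
  obtain ⟨⟨z, x⟩, -, θ, hθ, hlim⟩ := (isCompact_Icc.prod isCompact_Icc).tendsto_subseq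
    (x := fun k => (y (ψ (k + 2) - 2), y (ψ (k + 2) - 2 + 1))) (s := Icc L U ×ˢ Icc L U)
    (fun k => ⟨hy _, hy _⟩)
  have hge : ∀ k, k + 2 ≤ ψ (k + 2) := fun k => hψ.id_le (k + 2)
  refine ⟨z, x, fun k => ψ (θ k + 2) - 2, ?_, ?_, ?_, ?_⟩
  · refine tendsto_atTop_mono (fun k => ?_) tendsto_id
    have := hge (θ k)
    have := hθ.id_le k
    simp only [id] at *
    omega
  · exact (continuous_fst.tendsto _).comp hlim
  · exact (continuous_snd.tendsto _).comp hlim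
  · have h : (fun k => y (ψ (θ k + 2) - 2 + 2)) = fun k => (y ∘ ψ) (θ k + 2) := by
      funext k
      have := hge (θ k)
      simp only [Function.comp]
      congr 1
      omega
    rw [h]
    exact hψw.comp ((tendsto_add_atTop_nat 2).comp hθ.tendsto_atTop)

lemma eq_of_tendsto {p q r x z w : ℝ} {y : ℕ → ℝ}
    (hrec : ∀ n, y (n + 2) * (q * y (n + 1) + y n) = r + p * y (n + 1) + y n) {χ : ℕ → ℕ}
    (hz : Tendsto (fun k => y (χ k)) atTop (𝓝 z))
    (hx : Tendsto (fun k => y (χ k + 1)) atTop (𝓝 x))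
    (hw : Tendsto (fun k => y (χ k + 2)) atTop (𝓝 w)) :
    w * (q * x + z) = r + p * x + z := by
  refine tendsto_nhds_unique (hw.mul ((hx.const_mul q).add hz)) ?_
  simp only [hrec]
  exact ((hx.const_mul p).const_add r).add hz

lemma tendsto_lyapNum_div_lyapDen {p q r a b : ℝ} {f g : ℕ → ℝ} (hf : Tendsto f atTop (𝓝 a))
    (hg : Tendsto g atTop (𝓝 b)) (h : lyapDen p q r a b ≠ 0) :
    Tendsto (fun k => lyapNum p q r (f k) (g k) / lyapDen p q r (f k) (g k)) atTop
      (𝓝 (lyapNum p q r a b / lyapDen p q r a b)) := by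
  have hN : Continuous fun v : ℝ × ℝ => lyapNum p q r v.1 v.2 := by
    unfold lyapNum; fun_prop
  have hD : Continuous fun v : ℝ × ℝ => lyapDen p q r v.1 v.2 := by
    unfold lyapDen; fun_prop
  have h1 := (hN.tendsto (a, b)).comp (hf.prodMk_nhds hg)
  have h2 := (hD.tendsto (a, b)).comp (hf.prodMk_nhds hg)
  exact h1.div h2 h

lemma eq_of_eventually_antitone {W : ℕ → ℝ} {N : ℕ} (hW : Antitone fun n => W (n + N))
    {χ : ℕ → ℕ} (hχ : Tendsto χ atTop atTop) {a b : ℝ}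
    (ha : Tendsto (fun k => W (χ k)) atTop (𝓝 a))
    (hb : Tendsto (fun k => W (χ k + 1)) atTop (𝓝 b)) : a = b := by
  rcases tendsto_atTop_of_antitone hW with h | ⟨l, h⟩
  · have h' : Tendsto W atTop atBot := (tendsto_add_atTop_iff_nat N).1 h
    exact absurd (h'.comp hχ) (not_tendsto_atBot_of_tendsto_nhds ha)
  · have h' : Tendsto W atTop (𝓝 l) := (tendsto_add_atTop_iff_nat N).1 h
    rw [tendsto_nhds_unique ha (h'.comp hχ),
      tendsto_nhds_unique hb (h'.comp ((tendsto_add_atTop_nat 1).comp hχ))]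

/-- The Lyapunov function takes the same value on consecutive pairs of any limiting triple, which
forces the outer entries of the triple to agree. -/
lemma limit_triple_periodic {p q r I S : ℝ} (hp : 0 < p) (hq : 0 < q) (hq1 : q < 1) (hr : 0 < r)
    {y : ℕ → ℝ} (hy1 : ∀ n, 1 ≤ y n)
    (hrec : ∀ n, y (n + 2) * (q * y (n + 1) + y n) = r + p * y (n + 1) + y n)
    (hIS : I < S) (hI1 : 1 ≤ I)
    (hI : 0 < -q * I ^ 2 + 2 * p * I - p - q * r) (hS : 0 < -q * S ^ 2 + 2 * p * S - p - q * r)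
    (hev : ∀ O : Set ℝ, IsOpen O → Icc I S ⊆ O → ∀ᶠ n in atTop, y n ∈ O)
    {χ : ℕ → ℕ} (hχ : Tendsto χ atTop atTop) {x z w : ℝ} (hxI : x ∈ Icc I S) (hz1 : 1 ≤ z)
    (hw1 : 1 ≤ w) (hz : Tendsto (fun k => y (χ k)) atTop (𝓝 z))
    (hx : Tendsto (fun k => y (χ k + 1)) atTop (𝓝 x))
    (hw : Tendsto (fun k => y (χ k + 2)) atTop (𝓝 w)) : z = w := by
  have hpos : ∀ t ∈ Icc I S, 0 < -q * t ^ 2 + 2 * p * t - p - q * r := by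
    intro t ht
    have h1 : (S - I) * (-q * t ^ 2 + 2 * p * t - p - q * r) =
        (S - t) * (-q * I ^ 2 + 2 * p * I - p - q * r)
          + (t - I) * (-q * S ^ 2 + 2 * p * S - p - q * r)
          + (S - I) * (q * ((S - t) * (t - I))) := by ring
    have h2 : 0 ≤ S - t := sub_nonneg.2 ht.2
    have h3 : 0 ≤ t - I := sub_nonneg.2 ht.1
    have h4 : 0 < S - I := sub_pos.2 hIS
    have h5 : 0 < (S - t) * (-q * I ^ 2 + 2 * p * I - p - q * r)
          + (t - I) * (-q * S ^ 2 + 2 * p * S - p - q * r) := by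
      rcases h2.eq_or_lt with h | h
      · rw [← h, zero_mul, zero_add]
        exact mul_pos (by linarith) hS
      · exact add_pos_of_pos_of_nonneg (mul_pos h hI) (mul_nonneg h3 hS.le)
    have h6 : 0 ≤ (S - I) * (q * ((S - t) * (t - I))) := by positivity
    exact pos_of_mul_pos_right (by rw [h1]; linarith) h4.le
  obtain ⟨N, hN⟩ := eventually_atTop.1 (hev {t | 0 < -q * t ^ 2 + 2 * p * t - p - q * r}
    (isOpen_lt continuous_const (by fun_prop)) hpos)
  have hfac : ∀ t : ℝ, 1 ≤ t → 0 < -q * t ^ 2 + 2 * p * t - p - q * r →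
      0 < (2 - q) * ((2 - q) * t + 2 * p - 1) * (-q * t ^ 2 + 2 * p * t - p - q * r)
        * ((1 + q * t) / 2) := by
    intro t ht h
    have h1 : 0 < 2 - q := by linarith
    have h2 : 0 < (2 - q) * t + 2 * p - 1 := by nlinarith
    have h3 : 0 < (1 + q * t) / 2 := by nlinarith
    positivity
  have hden : ∀ a b : ℝ, 1 ≤ a → 1 ≤ b → 0 < lyapDen p q r a b :=
    fun a b => lyapDen_pos hp hq hq1 hr
  set V : ℝ → ℝ → ℝ := fun a b => lyapNum p q r a b / lyapDen p q r a b with hV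
  have hanti : Antitone fun n => V (y (n + N + 1)) (y (n + N)) := by
    refine antitone_nat_of_succ_le fun n => ?_
    have hc := lyap_cross p q r (y (n + N + 1)) (y (n + N)) (y (n + N + 2)) (hrec _)
    have hf := hfac _ (hy1 (n + N + 1)) (hN (n + N + 1) (by omega))
    have := mul_nonneg hf.le (sq_nonneg (y (n + N) - y (n + N + 2)))
    rw [show n + 1 + N = n + N + 1 by ring]
    simp only [hV]
    rw [div_le_div_iff₀ (hden _ _ (hy1 _) (hy1 _)) (hden _ _ (hy1 _) (hy1 _))]
    linarith
  have hx1 : 1 ≤ x := hI1.trans hxI.1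
  have hl1 := tendsto_lyapNum_div_lyapDen hx hz (hden x z hx1 hz1).ne'
  have hl2 := tendsto_lyapNum_div_lyapDen hw hx (hden w x hw1 hx1).ne'
  have hVeq : V x z = V w x :=
    eq_of_eventually_antitone (W := fun n => V (y (n + 1)) (y n)) hanti hχ hl1 hl2
  have hc := lyap_cross p q r x z w (eq_of_tendsto hrec hz hx hw)
  simp only [hV] at hVeq
  rw [div_eq_div_iff (hden _ _ hx1 hz1).ne' (hden _ _ hw1 hx1).ne'] at hVeq
  have h0 := hfac x hx1 (hpos x hxI)
  rw [hVeq, sub_self] at hc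
  rcases mul_eq_zero.1 hc.symm with h | h
  · exact absurd h h0.ne'
  · exact sub_eq_zero.1 (pow_eq_zero_iff two_ne_zero |>.1 h)

/-- Eventual monotonicity of the two parity classes when the recurrence function is decreasing in
the newer term and increasing in the older one. -/
lemma exists_tendsto_parity {p q r : ℝ} (hp : 0 < p) (hpq : p < q) (hr : 0 < r)
    {y : ℕ → ℝ} {L U : ℝ} (hL : 0 < L) (hy : ∀ n, y n ∈ Icc L U)
    (hrec : ∀ n, y (n + 2) * (q * y (n + 1) + y n) = r + p * y (n + 1) + y n) {N : ℕ}
    (hN : ∀ n ≥ N, r < (q - p) * y n) :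
    ∃ m a b, Tendsto (fun k => y (m + 2 * k)) atTop (𝓝 a) ∧
      Tendsto (fun k => y (m + 1 + 2 * k)) atTop (𝓝 b) := by
  have hpos : ∀ n, 0 < y n := fun n => hL.trans_le (hy n).1
  have hq : 0 < q := hp.trans hpq
  have hden : ∀ n, 0 < q * y (n + 1) + y n := fun n => by
    have := mul_pos hq (hpos (n + 1)); have := hpos n; linarith
  -- monotonicity of one step
  have hstep : ∀ i j, N ≤ i → N ≤ j → y (i + 1) ≤ y (j + 1) → y j ≤ y i →
      y (j + 2) ≤ y (i + 2) := by
    intro i j hi hj h1 h2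
    have e1 : y (i + 2) = (r + p * y (i + 1) + y i) / (q * y (i + 1) + y i) :=
      eq_div_of_mul_eq (hden i).ne' (hrec i)
    have e2 : y (j + 2) = (r + p * y (j + 1) + y j) / (q * y (j + 1) + y j) :=
      eq_div_of_mul_eq (hden j).ne' (hrec j)
    rw [e1, e2, div_le_div_iff₀ (hden j) (hden i)]
    have h3 := hN (i + 1) (by omega)
    have h4 := hN i hi
    have h5 := hN j hj
    have h6 := hN (j + 1) (by omega)
    have hr0 : 0 ≤ (y (j + 1) - y (i + 1)) * (q * r + (q - p) * y j) :=
      mul_nonneg (by linarith) (by linarith [mul_pos hq hr, mul_pos (sub_pos.2 hpq) (hpos j)])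
    have hr1 : 0 ≤ (y i - y j) * ((q - p) * y (j + 1) - r) :=
      mul_nonneg (by linarith) (by linarith)
    linarith
  have hmono : ∀ {f : ℕ → ℝ}, (∀ k, f k ∈ Icc L U) → Monotone f → ∃ a, Tendsto f atTop (𝓝 a) :=
    fun hf h => ⟨_, tendsto_atTop_ciSup h ⟨U, by rintro _ ⟨k, rfl⟩; exact (hf k).2⟩⟩
  have hanti : ∀ {f : ℕ → ℝ}, (∀ k, f k ∈ Icc L U) → Antitone f → ∃ a, Tendsto f atTop (𝓝 a) :=
    fun hf h => ⟨_, tendsto_atTop_ciInf h ⟨L, by rintro _ ⟨k, rfl⟩; exact (hf k).1⟩⟩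
  by_cases h1 : ∃ m ≥ N, y m ≤ y (m + 2) ∧ y (m + 3) ≤ y (m + 1)
  · obtain ⟨m, hm, h0⟩ := h1
    have hall : ∀ k, y (m + 2 * k) ≤ y (m + 2 * k + 2) ∧ y (m + 2 * k + 3) ≤ y (m + 2 * k + 1) := by
      intro k
      induction k with
      | zero => simpa using h0
      | succ k ih =>
        have h4 := hstep (m + 2 * k + 2) (m + 2 * k) (by omega) (by omega) ih.2 ih.1
        have h5 := hstep (m + 2 * k + 1) (m + 2 * k + 3) (by omega) (by omega) h4 ih.2
        exact ⟨h4, h5⟩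
    obtain ⟨a, ha⟩ := hmono (f := fun k => y (m + 2 * k)) (fun k => hy _)
      (monotone_nat_of_le_succ fun k => (hall k).1)
    obtain ⟨b, hb⟩ := hanti (f := fun k => y (m + 1 + 2 * k)) (fun k => hy _)
      (antitone_nat_of_succ_le fun k => by
        show y (m + 1 + 2 * (k + 1)) ≤ y (m + 1 + 2 * k)
        convert (hall k).2 using 2 <;> ring)
    exact ⟨m, a, b, ha, hb⟩
  by_cases h2 : ∃ m ≥ N, y (m + 2) ≤ y m ∧ y (m + 1) ≤ y (m + 3)
  · obtain ⟨m, hm, h0⟩ := h2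
    have hall : ∀ k, y (m + 2 * k + 2) ≤ y (m + 2 * k) ∧ y (m + 2 * k + 1) ≤ y (m + 2 * k + 3) := by
      intro k
      induction k with
      | zero => simpa using h0
      | succ k ih =>
        have h4 := hstep (m + 2 * k) (m + 2 * k + 2) (by omega) (by omega) ih.2 ih.1
        have h5 := hstep (m + 2 * k + 3) (m + 2 * k + 1) (by omega) (by omega) h4 ih.2
        exact ⟨h4, h5⟩
    obtain ⟨a, ha⟩ := hanti (f := fun k => y (m + 2 * k)) (fun k => hy _)
      (antitone_nat_of_succ_le fun k => (hall k).1)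
    obtain ⟨b, hb⟩ := hmono (f := fun k => y (m + 1 + 2 * k)) (fun k => hy _)
      (monotone_nat_of_le_succ fun k => by
        show y (m + 1 + 2 * k) ≤ y (m + 1 + 2 * (k + 1))
        convert (hall k).2 using 2 <;> ring)
    exact ⟨m, a, b, ha, hb⟩
  push Not at h1 h2
  rcases le_total (y N) (y (N + 2)) with h0 | h0
  · have hall : ∀ k, y (N + k) ≤ y (N + k + 2) := by
      intro k
      induction k with
      | zero => simpa using h0
      | succ k ih => exact (h1 (N + k) (by omega) ih).le
    obtain ⟨a, ha⟩ := hmono (f := fun k => y (N + 2 * k)) (fun k => hy _)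
      (monotone_nat_of_le_succ fun k => hall (2 * k))
    obtain ⟨b, hb⟩ := hmono (f := fun k => y (N + 1 + 2 * k)) (fun k => hy _)
      (monotone_nat_of_le_succ fun k => by
        show y (N + 1 + 2 * k) ≤ y (N + 1 + 2 * (k + 1))
        convert hall (2 * k + 1) using 2 <;> ring)
    exact ⟨N, a, b, ha, hb⟩
  · have hall : ∀ k, y (N + k + 2) ≤ y (N + k) := by
      intro k
      induction k with
      | zero => simpa using h0
      | succ k ih => exact (h2 (N + k) (by omega) ih).le
    obtain ⟨a, ha⟩ := hanti (f := fun k => y (N + 2 * k)) (fun k => hy _)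
      (antitone_nat_of_succ_le fun k => hall (2 * k))
    obtain ⟨b, hb⟩ := hanti (f := fun k => y (N + 1 + 2 * k)) (fun k => hy _)
      (antitone_nat_of_succ_le fun k => by
        show y (N + 1 + 2 * (k + 1)) ≤ y (N + 1 + 2 * k)
        convert hall (2 * k + 1) using 2 <;> ring)
    exact ⟨N, a, b, ha, hb⟩

lemma tendsto_or_parity {p q r : ℝ} (hp : 0 < p) (hq : 0 < q) (hr : 0 < r) {y : ℕ → ℝ} {L U : ℝ}
    (hL : 0 < L) (hL1 : q ≤ p → 1 ≤ L) (hy : ∀ n, y n ∈ Icc L U)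
    (hrec : ∀ n, y (n + 2) * (q * y (n + 1) + y n) = r + p * y (n + 1) + y n) :
    (∃ w, Tendsto y atTop (𝓝 w)) ∨
      ∃ m a b, Tendsto (fun k => y (m + 2 * k)) atTop (𝓝 a) ∧
        Tendsto (fun k => y (m + 1 + 2 * k)) atTop (𝓝 b) := by
  have hbU : IsBoundedUnder (· ≤ ·) atTop y := isBoundedUnder_of ⟨U, fun n => (hy n).2⟩
  have hbL : IsBoundedUnder (· ≥ ·) atTop y := isBoundedUnder_of ⟨L, fun n => (hy n).1⟩
  obtain ⟨hSm, hSu⟩ := isGreatest_mapClusterPt_limsup hbL.isCoboundedUnder_le hbU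
  obtain ⟨hIm, hIl⟩ := isLeast_mapClusterPt_liminf hbU.isCoboundedUnder_ge hbL
  set S := limsup y atTop
  set I := liminf y atTop
  have hmem : ∀ {w : ℝ}, MapClusterPt w atTop y → w ∈ Icc I S := fun h => ⟨hIl h, hSu h⟩
  have hmem' : ∀ {w : ℝ} {χ : ℕ → ℕ}, Tendsto χ atTop atTop →
      Tendsto (fun k => y (χ k)) atTop (𝓝 w) → w ∈ Icc I S :=
    fun hχ h => hmem (MapClusterPt.of_comp hχ (Tendsto.mapClusterPt h))
  have hLI : L ≤ I := isClosed_Ici.mem_of_mapClusterPt hIm (.of_forall fun n => (hy n).1)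
  rcases (hIl hSm : I ≤ S).eq_or_lt with hIS | hIS
  · exact .inl ⟨S, tendsto_of_liminf_eq_limsup hIS rfl hbU hbL⟩
  obtain ⟨z, x, χ, hχ, hz, hx, hw⟩ := exists_tendsto_triple hy hSm
  obtain ⟨z', x', χ', hχ', hz', hx', hw'⟩ := exists_tendsto_triple hy hIm
  have hzm := hmem' hχ hz
  have hxm := hmem' ((tendsto_add_atTop_nat 1).comp hχ) hx
  have hzm' := hmem' hχ' hz'
  have hxm' := hmem' ((tendsto_add_atTop_nat 1).comp hχ') hx'
  have hSe := eq_of_tendsto hrec hz hx hw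
  have hIe := eq_of_tendsto hrec hz' hx' hw'
  have hI0 : 0 < I := hL.trans_le hLI
  have hev : ∀ O : Set ℝ, IsOpen O → Icc I S ⊆ O → ∀ᶠ n in atTop, y n ∈ O := by
    intro O hO hsub
    by_contra h
    obtain ⟨a, ha, hac⟩ := (isCompact_Icc.diff hO).exists_mapClusterPt_of_frequently
      ((not_eventually.1 h).mono fun n hn => (⟨hy n, hn⟩ : y n ∈ Icc L U \ O))
    exact ha.2 (hsub (hmem hac))
  rcases le_or_gt q p with hpq | hpq
  · exfalso
    obtain ⟨hq1, hI1, hhI, hhS, hqS⟩ :=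
      extremes_of_le_of_lt hq hr hpq hI0 hIS hxm hzm hxm' hzm' hSe hIe
    have hy1 : ∀ n, 1 ≤ y n := fun n => (hL1 hpq).trans (hy n).1
    have e1 : z = S := limit_triple_periodic hp hq hq1 hr hy1 hrec hIS hI1 hhI hhS hev hχ hxm
      (hI1.trans hzm.1) (hI1.trans hIS.le) hz hx hw
    have e2 : z' = I := limit_triple_periodic hp hq hq1 hr hy1 hrec hIS hI1 hhI hhS hev hχ' hxm'
      (hI1.trans hzm'.1) hI1 hz' hx' hw'
    rw [e1] at hSe
    rw [e2] at hIe
    have h1 := mul_le_mul_of_nonneg_left hxm.2 (sub_nonneg.2 hqS.le)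
    have h2 := mul_le_mul_of_nonneg_left hxm'.1
      (by linarith [mul_lt_mul_of_pos_left hIS hq] : 0 ≤ p - q * I)
    -- both extreme points are compared with the equilibrium
    have h3 : (q + 1) * (S * S) ≤ r + (p + 1) * S := by linarith
    have h4 : r + (p + 1) * I ≤ (q + 1) * (I * I) := by linarith
    have h5 := mul_le_mul_of_nonneg_right h3 hI0.le
    have h6 := mul_le_mul_of_nonneg_right h4 (hI0.trans hIS).le
    have h7 := mul_pos (mul_pos (by linarith : 0 < q + 1) (mul_pos hI0 (hI0.trans hIS)))
      (sub_pos.2 hIS)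
    have h8 := mul_pos hr (sub_pos.2 hIS)
    linarith
  · right
    have hd := increasing_region_of_lt hp hpq hr hI0 hIS hxm hzm hxm' hzm' hSe hIe
    obtain ⟨N, hN⟩ := eventually_atTop.1 (hev {t | r < (q - p) * t}
      (isOpen_lt continuous_const (by fun_prop))
      fun t ht => hd.trans_le (mul_le_mul_of_nonneg_left ht.1 (sub_pos.2 hpq).le))
    exact exists_tendsto_parity hp hpq hr hL hy hrec hN

lemma eq_equilibrium {p q r w : ℝ} (hp : 0 < p) (hq : 0 < q) (hr : 0 < r) (hw : 0 < w)
    (h : w * (q * w + w) = r + p * w + w) :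
    w = (p + 1 + Real.sqrt ((p + 1) ^ 2 + 4 * r * (q + 1))) / (2 * (q + 1)) := by
  have h1 : (p + 1) ^ 2 + 4 * r * (q + 1) = (2 * (q + 1) * w - (p + 1)) ^ 2 := by
    linear_combination (-4) * (q + 1) * h
  have h2 : 0 ≤ 2 * (q + 1) * w - (p + 1) := by
    by_contra! h3
    have := mul_neg_of_neg_of_pos h3 hw
    nlinarith [mul_pos hp hw]
  rw [h1, Real.sqrt_sq h2]
  field_simp
  ring

lemma exists_eventual_bounds {p q r : ℝ} (hp : 0 < p) (hq : 0 < q) (hr : 0 < r) {y : ℕ → ℝ}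
    (hpos : ∀ n, 0 < y n)
    (hrec : ∀ n, y (n + 2) * (q * y (n + 1) + y n) = r + p * y (n + 1) + y n) :
    ∃ L U : ℝ, 0 < L ∧ (q ≤ p → 1 ≤ L) ∧ ∀ n, y (n + 4) ∈ Icc L U := by
  have hden : ∀ n, 0 < q * y (n + 1) + y n := fun n =>
    add_pos (mul_pos hq (hpos _)) (hpos n)
  have hL0 : 0 < min 1 (p / q) := lt_min one_pos (div_pos hp hq)
  have hU0 : 0 < max 1 (p / q) := lt_max_of_lt_left one_pos
  set L := min 1 (p / q)
  set M := max 1 (p / q)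
  have hLq : L * q ≤ p := (le_div_iff₀ hq).1 (min_le_right _ _)
  have hMq : p ≤ M * q := (div_le_iff₀ hq).1 (le_max_right _ _)
  have hL1 : L ≤ 1 := min_le_left _ _
  have hM1 : 1 ≤ M := le_max_left _ _
  have hlow : ∀ n, L ≤ y (n + 2) := by
    intro n
    refine le_of_mul_le_mul_right ?_ (hden n)
    rw [hrec n]
    have h1 := mul_le_mul_of_nonneg_right hLq (hpos (n + 1)).le
    have h2 := mul_le_mul_of_nonneg_right hL1 (hpos n).le
    linarith
  refine ⟨L, r / ((q + 1) * L) + M, hL0, fun h => le_min le_rfl ((one_le_div hq).2 h),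
    fun n => ⟨hlow (n + 2), ?_⟩⟩
  refine le_of_mul_le_mul_right ?_ (hden (n + 2))
  rw [hrec (n + 2)]
  have h1 := mul_le_mul_of_nonneg_right hMq (hpos (n + 3)).le
  have h2 := mul_le_mul_of_nonneg_right hM1 (hpos (n + 2)).le
  have h3 : (q + 1) * L ≤ q * y (n + 3) + y (n + 2) := by
    have := mul_le_mul_of_nonneg_left (hlow (n + 1)) hq.le
    have := hlow n
    linarith
  have h4 : r ≤ r / ((q + 1) * L) * (q * y (n + 3) + y (n + 2)) := by
    rw [div_mul_eq_mul_div, le_div_iff₀ (by positivity)]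
    gcongr
  linarith

lemma tendsto_of_tendsto_parity {y : ℕ → ℝ} {a : ℝ}
    (h0 : Tendsto (fun n => y (2 * n)) atTop (𝓝 a))
    (h1 : Tendsto (fun n => y (2 * n + 1)) atTop (𝓝 a)) : Tendsto y atTop (𝓝 a) := by
  rw [Metric.tendsto_atTop] at *
  intro ε hε
  obtain ⟨M, hM⟩ := h0 ε hε
  obtain ⟨N, hN⟩ := h1 ε hε
  refine ⟨2 * M + 2 * N + 1, fun n hn => ?_⟩
  obtain ⟨k, rfl | rfl⟩ := n.even_or_odd'
  · exact hM k (by omega)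
  · exact hN k (by omega)

/-- Theorem (Eq. (3-2)): for positive `p, q, r`, every positive solution
converges to the unique positive equilibrium or to a prime period-two
solution. Here `y 0` plays the role of `y_{-1}` and `y 1` of `y_0`. -/
theorem stmt_3 (p q r : ℝ) (hp : 0 < p) (hq : 0 < q) (hr : 0 < r)
    (y : ℕ → ℝ) (hpos : ∀ n : ℕ, 0 < y n)
    (hrec : ∀ n : ℕ, y (n + 2) = (r + p * y (n + 1) + y n) / (q * y (n + 1) + y n)) :
    Tendsto y atTop
      (nhds ((p + 1 + Real.sqrt ((p + 1) ^ 2 + 4 * r * (q + 1))) / (2 * (q + 1)))) ∨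
      ∃ φ ψ : ℝ, φ ≠ ψ ∧ 0 < φ ∧ 0 < ψ ∧
        φ = (r + p * ψ + φ) / (q * ψ + φ) ∧
        ψ = (r + p * φ + ψ) / (q * φ + ψ) ∧
        ((Tendsto (fun n => y (2 * n)) atTop (nhds φ) ∧
          Tendsto (fun n => y (2 * n + 1)) atTop (nhds ψ)) ∨
         (Tendsto (fun n => y (2 * n)) atTop (nhds ψ) ∧
          Tendsto (fun n => y (2 * n + 1)) atTop (nhds φ))) := by
  have hden : ∀ n, 0 < q * y (n + 1) + y n := fun n =>
    add_pos (mul_pos hq (hpos _)) (hpos n)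
  have hrec' : ∀ n, y (n + 2) * (q * y (n + 1) + y n) = r + p * y (n + 1) + y n := fun n => by
    rw [hrec n, div_mul_cancel₀ _ (hden n).ne']
  obtain ⟨L, U, hL, hL1, hLU⟩ := exists_eventual_bounds hp hq hr hpos hrec'
  have hge : ∀ {w : ℝ} {χ : ℕ → ℕ}, Tendsto χ atTop atTop →
      Tendsto (fun k => y (χ k)) atTop (𝓝 w) → 0 < w := by
    intro w χ hχ h
    refine hL.trans_le (ge_of_tendsto h ((hχ.eventually_ge_atTop 4).mono fun k hk => ?_))
    have := (hLU (χ k - 4)).1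
    rwa [Nat.sub_add_cancel hk] at this
  have hconv : ∀ {w : ℝ}, Tendsto y atTop (𝓝 w) → Tendsto y atTop
      (nhds ((p + 1 + Real.sqrt ((p + 1) ^ 2 + 4 * r * (q + 1))) / (2 * (q + 1)))) := by
    intro w h
    rwa [← eq_equilibrium hp hq hr (hge tendsto_id h) (eq_of_tendsto hrec' (χ := id) h
      (h.comp (tendsto_add_atTop_nat 1)) (h.comp (tendsto_add_atTop_nat 2)))]
  have hfin : ∀ {a b : ℝ}, Tendsto (fun n => y (2 * n)) atTop (𝓝 a) →
      Tendsto (fun n => y (2 * n + 1)) atTop (𝓝 b) →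
      0 < a ∧ 0 < b ∧ a = (r + p * b + a) / (q * b + a) ∧ b = (r + p * a + b) / (q * a + b) := by
    intro a b ha hb
    have h2 : Tendsto (fun n : ℕ => 2 * n) atTop atTop :=
      tendsto_atTop_mono (fun n => by simp only [id]; omega) tendsto_id
    have h3 : Tendsto (fun n : ℕ => 2 * n + 1) atTop atTop := (tendsto_add_atTop_nat 1).comp h2
    have ha' : Tendsto (fun n => y (2 * n + 2)) atTop (𝓝 a) :=
      ha.comp (tendsto_add_atTop_nat 1)
    have hb' : Tendsto (fun n => y (2 * n + 1 + 2)) atTop (𝓝 b) :=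
      hb.comp (tendsto_add_atTop_nat 1)
    have ha0 := hge h2 ha
    have hb0 := hge h3 hb
    exact ⟨ha0, hb0, eq_div_of_mul_eq (by positivity) (eq_of_tendsto hrec' ha hb ha'),
      eq_div_of_mul_eq (by positivity) (eq_of_tendsto hrec' hb ha' hb')⟩
  rcases tendsto_or_parity hp hq hr hL hL1 hLU (fun n => hrec' (n + 4)) with
    ⟨w, h⟩ | ⟨m, a, b, ha, hb⟩
  · exact .inl (hconv ((tendsto_add_atTop_iff_nat 4).1 h))
  · obtain ⟨a, b, ha, hb⟩ : ∃ a b, Tendsto (fun n => y (2 * n)) atTop (𝓝 a) ∧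
        Tendsto (fun n => y (2 * n + 1)) atTop (𝓝 b) := by
      obtain ⟨j, rfl | rfl⟩ := m.even_or_odd'
      · refine ⟨a, b, (tendsto_add_atTop_iff_nat (j + 2)).1 ?_,
          (tendsto_add_atTop_iff_nat (j + 2)).1 ?_⟩
        · convert ha using 3; ring
        · convert hb using 3; ring
      · refine ⟨b, a, (tendsto_add_atTop_iff_nat (j + 3)).1 ?_,
          (tendsto_add_atTop_iff_nat (j + 2)).1 ?_⟩
        · convert hb using 3; ring
        · convert ha using 3; ring
    rcases eq_or_ne a b with rfl | hab
    · exact .inl (hconv (tendsto_of_tendsto_parity ha hb))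
    · obtain ⟨h1, h2, h3, h4⟩ := hfin ha hb
      exact .inr ⟨a, b, hab, h1, h2, h3, h4, .inl ⟨ha, hb⟩⟩
end

section
/- Let p, q > 0 and r ≥ 0, set f(x,y) = (r + p·x + y)/(q·x + y) for x, y > 0, and let ȳ = (p+1+√((p+1)² + 4r(q+1)))/(2(q+1)). Then at least one of the following holds. (A) Every sequence (x_n)_{n≥-1} of positive reals satisfying x_{n+1} = f(x_n, x_{n-1}) for all n ≥ 0 converges to ȳ. (B) There exist real numbers m*, M* with 0 < m* < M* such that: (i) f(x,y) ∈ [m*, M*] for all x, y ∈ [m*, M*]; (ii) for every positive solution (x_n)_{n≥-1} there is an N with x_n ∈ [m*, M*] for all n ≥ N; and (iii) f is coordinate-wise strictly monotonic on [m*, M*]², i.e., either x ↦ f(x,y) is strictly increasing on [m*, M*] for every y ∈ [m*, M*] or it is strictly decreasing on [m*, M*] for every y ∈ [m*, M*], and likewise y ↦ f(x,y) is strictly increasing on [m*, M*] for every x ∈ [m*, M*] or strictly decreasing on [m*, M*] for every x ∈ [m*, M*]. -/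
open Filter Topology Set

theorem eventually_atTop_of_even_odd {P : ℕ → Prop} (h0 : ∀ᶠ k in atTop, P (2 * k))
    (h1 : ∀ᶠ k in atTop, P (2 * k + 1)) : ∀ᶠ n in atTop, P n := by
  obtain ⟨N0, h0⟩ := eventually_atTop.1 h0
  obtain ⟨N1, h1⟩ := eventually_atTop.1 h1
  refine eventually_atTop.2 ⟨2 * (N0 + N1) + 1, fun n hn => ?_⟩
  rcases Nat.even_or_odd' n with ⟨k, rfl | rfl⟩
  · exact h0 k (by omega)
  · exact h1 k (by omega)

theorem tendsto_atTop_of_even_odd {α : Type*} {l : Filter α} {x : ℕ → α}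
    (h0 : Tendsto (fun k => x (2 * k)) atTop l) (h1 : Tendsto (fun k => x (2 * k + 1)) atTop l) :
    Tendsto x atTop l := fun _ hU =>
  eventually_atTop_of_even_odd (h0.eventually_mem hU) (h1.eventually_mem hU)

/-- A sequence that cannot leave `[a, b]`, cannot stay on one side of it, and whose peaks decrease
by a fixed fraction of its oscillation is eventually trapped in `[a, b]`, unless `a = b` and it
converges to `a`. -/
theorem eventually_mem_Icc_or_tendsto {z : ℕ → ℝ} {a b δ : ℝ} (hab : a ≤ b) (hδ : 0 < δ)
    (hin : ∀ n, z n ∈ Icc a b → z (n + 1) ∈ Icc a b)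
    (hlo : ∀ n, z n < a → a ≤ z (n + 1)) (hhi : ∀ n, b < z n → z (n + 1) ≤ b)
    (hdrop : ∀ n, b < z n → z (n + 1) < a → b < z (n + 2) →
      δ * (z n - z (n + 1)) ≤ z n - z (n + 2)) :
    (∀ᶠ n in atTop, z n ∈ Icc a b) ∨ (a = b ∧ Tendsto z atTop (𝓝 a)) := by
  by_cases h : ∃ N, z N ∈ Icc a b
  · obtain ⟨N, hN⟩ := h
    exact .inl (eventually_atTop.2 ⟨N, fun n hn => Nat.le_induction hN (fun n _ => hin n) n hn⟩)
  right
  have hout : ∀ n, z n < a ∨ b < z n := fun n => by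
    by_contra! hn
    exact h ⟨n, hn⟩
  have up : ∀ n, z n < a → b < z (n + 1) := fun n hn =>
    (hout (n + 1)).resolve_left (not_lt.2 (hlo n hn))
  have down : ∀ n, b < z n → z (n + 1) < a := fun n hn =>
    (hout (n + 1)).resolve_right (not_lt.2 (hhi n hn))
  obtain ⟨N, hN⟩ : ∃ N, b < z N := by
    rcases hout 0 with h0 | h0
    exacts [⟨1, up 0 h0⟩, ⟨0, h0⟩]
  have hH : ∀ k, b < z (2 * k + N) := fun k => by
    induction k with
    | zero => simpa using hN
    | succ k ih =>
      have := up _ (down _ ih)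
      rwa [show 2 * (k + 1) + N = 2 * k + N + 1 + 1 by ring]
  have hL : ∀ k, z (2 * k + 1 + N) < a := fun k => by
    rw [show 2 * k + 1 + N = 2 * k + N + 1 by ring]
    exact down _ (hH k)
  have hd : ∀ k, δ * (z (2 * k + N) - z (2 * k + 1 + N)) ≤
      z (2 * k + N) - z (2 * (k + 1) + N) := fun k => by
    have h3 := hH (k + 1)
    have h2 := hL k
    rw [show 2 * k + 1 + N = 2 * k + N + 1 by ring] at h2 ⊢
    rw [show 2 * (k + 1) + N = 2 * k + N + 2 by ring] at h3 ⊢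
    exact hdrop _ (hH k) h2 h3
  have hanti : Antitone fun k => z (2 * k + N) := antitone_nat_of_succ_le fun k => by
    have h1 := hd k
    have h2 : 0 ≤ δ * (z (2 * k + N) - z (2 * k + 1 + N)) :=
      mul_nonneg hδ.le (by linarith [hL k, hH k])
    linarith
  have hbdd : BddBelow (range fun k => z (2 * k + N)) := ⟨b, by
    rintro _ ⟨k, rfl⟩
    exact (hH k).le⟩
  obtain ⟨H, hlimH⟩ : ∃ H, Tendsto (fun k => z (2 * k + N)) atTop (𝓝 H) :=
    ⟨_, tendsto_atTop_ciInf hanti hbdd⟩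
  have hgap : Tendsto (fun k => z (2 * k + N) - z (2 * k + 1 + N)) atTop (𝓝 0) := by
    have h1 : Tendsto (fun k => (z (2 * k + N) - z (2 * (k + 1) + N)) / δ) atTop (𝓝 0) := by
      simpa using (hlimH.sub ((tendsto_add_atTop_iff_nat 1).2 hlimH)).div_const δ
    refine tendsto_of_tendsto_of_tendsto_of_le_of_le tendsto_const_nhds h1
      (fun k => ?_) (fun k => ?_)
    · linarith [hL k, hH k]
    · simpa only [le_div_iff₀ hδ, mul_comm] using hd k
  have hlimL : Tendsto (fun k => z (2 * k + 1 + N)) atTop (𝓝 H) := by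
    simpa using hlimH.sub hgap
  have hbH : b ≤ H := ge_of_tendsto' hlimH fun k => (hH k).le
  have hHa : H ≤ a := le_of_tendsto' hlimL fun k => (hL k).le
  have hHeq : H = a := by linarith
  subst hHeq
  exact ⟨by linarith, (tendsto_add_atTop_iff_nat N).1 (tendsto_atTop_of_even_odd hlimH hlimL)⟩

theorem tendsto_of_eventually_mem_Icc_or_tendsto {z : ℕ → ℝ} {a : ℝ}
    (h : (∀ᶠ n in atTop, z n ∈ Icc a a) ∨ Tendsto z atTop (𝓝 a)) :
    Tendsto z atTop (𝓝 a) := by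
  rcases h with h | h
  · refine tendsto_const_nhds.congr' (h.mono fun n hn => ?_)
    exact le_antisymm hn.1 hn.2
  · exact h

section LinearFractional

variable {p q r : ℝ} {f : ℝ → ℝ → ℝ}

theorem linFrac_lt_left (hf : ∀ x y : ℝ, f x y = (r + p * x + y) / (q * x + y)) {x₁ x₂ y : ℝ}
    (h₁ : 0 < q * x₁ + y) (h₂ : 0 < q * x₂ + y) (h : 0 < (x₂ - x₁) * ((p - q) * y - q * r)) :
    f x₁ y < f x₂ y := by
  rw [hf, hf, div_lt_div_iff₀ h₁ h₂]
  linarith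

theorem linFrac_lt_right (hf : ∀ x y : ℝ, f x y = (r + p * x + y) / (q * x + y)) {x y₁ y₂ : ℝ}
    (h₁ : 0 < q * x + y₁) (h₂ : 0 < q * x + y₂) (h : 0 < (y₂ - y₁) * ((q - p) * x - r)) :
    f x y₁ < f x y₂ := by
  rw [hf, hf, div_lt_div_iff₀ h₁ h₂]
  linarith

theorem linFrac_le_left (hf : ∀ x y : ℝ, f x y = (r + p * x + y) / (q * x + y)) {x₁ x₂ y : ℝ}
    (h₁ : 0 < q * x₁ + y) (h₂ : 0 < q * x₂ + y) (h : 0 ≤ (x₂ - x₁) * ((p - q) * y - q * r)) :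
    f x₁ y ≤ f x₂ y := by
  rw [hf, hf, div_le_div_iff₀ h₁ h₂]
  linarith

theorem linFrac_le_right (hf : ∀ x y : ℝ, f x y = (r + p * x + y) / (q * x + y)) {x y₁ y₂ : ℝ}
    (h₁ : 0 < q * x + y₁) (h₂ : 0 < q * x + y₂) (h : 0 ≤ (y₂ - y₁) * ((q - p) * x - r)) :
    f x y₁ ≤ f x y₂ := by
  rw [hf, hf, div_le_div_iff₀ h₁ h₂]
  linarith

theorem linFrac_strictMonoOn_left (hf : ∀ x y : ℝ, f x y = (r + p * x + y) / (q * x + y))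
    (hq : 0 < q) {m M : ℝ} (hm : 0 < m) (h : ∀ y ∈ Icc m M, 0 < (p - q) * y - q * r) :
    ∀ y ∈ Icc m M, StrictMonoOn (fun x => f x y) (Icc m M) := fun y hy x₁ h₁ x₂ h₂ h₁₂ => by
  have hy0 := hm.trans_le hy.1
  have hx₁ := hm.trans_le h₁.1
  have hx₂ := hm.trans_le h₂.1
  exact linFrac_lt_left hf (by positivity) (by positivity) (mul_pos (sub_pos.2 h₁₂) (h y hy))

theorem linFrac_strictAntiOn_left (hf : ∀ x y : ℝ, f x y = (r + p * x + y) / (q * x + y))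
    (hq : 0 < q) {m M : ℝ} (hm : 0 < m) (h : ∀ y ∈ Icc m M, (p - q) * y - q * r < 0) :
    ∀ y ∈ Icc m M, StrictAntiOn (fun x => f x y) (Icc m M) := fun y hy x₁ h₁ x₂ h₂ h₁₂ => by
  have hy0 := hm.trans_le hy.1
  have hx₁ := hm.trans_le h₁.1
  have hx₂ := hm.trans_le h₂.1
  exact linFrac_lt_left hf (by positivity) (by positivity)
    (mul_pos_of_neg_of_neg (sub_neg.2 h₁₂) (h y hy))

theorem linFrac_strictMonoOn_right (hf : ∀ x y : ℝ, f x y = (r + p * x + y) / (q * x + y))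
    (hq : 0 < q) {m M : ℝ} (hm : 0 < m) (h : ∀ x ∈ Icc m M, 0 < (q - p) * x - r) :
    ∀ x ∈ Icc m M, StrictMonoOn (fun y => f x y) (Icc m M) := fun x hx y₁ h₁ y₂ h₂ h₁₂ => by
  have hx0 := hm.trans_le hx.1
  have hy₁ := hm.trans_le h₁.1
  have hy₂ := hm.trans_le h₂.1
  exact linFrac_lt_right hf (by positivity) (by positivity) (mul_pos (sub_pos.2 h₁₂) (h x hx))

theorem linFrac_strictAntiOn_right (hf : ∀ x y : ℝ, f x y = (r + p * x + y) / (q * x + y))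
    (hq : 0 < q) {m M : ℝ} (hm : 0 < m) (h : ∀ x ∈ Icc m M, (q - p) * x - r < 0) :
    ∀ x ∈ Icc m M, StrictAntiOn (fun y => f x y) (Icc m M) := fun x hx y₁ h₁ y₂ h₂ h₁₂ => by
  have hx0 := hm.trans_le hx.1
  have hy₁ := hm.trans_le h₁.1
  have hy₂ := hm.trans_le h₂.1
  exact linFrac_lt_right hf (by positivity) (by positivity)
    (mul_pos_of_neg_of_neg (sub_neg.2 h₁₂) (h x hx))

/-- If positive solutions are attracted to `[a, b]` and `f` maps the positive part of `[a, b]²`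
into `[m, M] ⊆ [a, b]`, then `[m, M]` is invariant and attracting. -/
theorem invariant_and_attracting {a b m M : ℝ} (hm : 0 < m) (ham : a ≤ m) (hMb : M ≤ b)
    (hmap : ∀ x y, 0 < x → 0 < y → x ∈ Icc a b → y ∈ Icc a b → f x y ∈ Icc m M)
    (hattr : ∀ x : ℕ → ℝ, (∀ n, 0 < x n) → (∀ n, x (n + 2) = f (x (n + 1)) (x n)) →
      ∀ᶠ n in atTop, x n ∈ Icc a b) :
    (∀ x ∈ Icc m M, ∀ y ∈ Icc m M, f x y ∈ Icc m M) ∧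
    (∀ x : ℕ → ℝ, (∀ n : ℕ, 0 < x n) → (∀ n : ℕ, x (n + 2) = f (x (n + 1)) (x n)) →
      ∃ N : ℕ, ∀ n ≥ N, x n ∈ Icc m M) := by
  refine ⟨fun x hx y hy => hmap x y (hm.trans_le hx.1) (hm.trans_le hy.1)
    (Icc_subset_Icc ham hMb hx) (Icc_subset_Icc ham hMb hy), fun x hx hrec => ?_⟩
  obtain ⟨N, hN⟩ := eventually_atTop.1 (hattr x hx hrec)
  refine ⟨N + 2, fun n hn => ?_⟩
  obtain ⟨k, rfl⟩ := Nat.exists_eq_add_of_le' (show 2 ≤ n by omega)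
  rw [hrec]
  exact hmap _ _ (hx _) (hx _) (hN _ (by omega)) (hN _ (by omega))

end LinearFractional

/-- With `p = K * q` and `r = L * (K - 1)`, where `K > 1`, each of the two interlaced subsequences
of a solution is eventually between `K` and `L`, or `K = L` is its limit. -/
theorem every_other_term_trapped {K L q : ℝ} (hK : 1 < K) (hL : 0 ≤ L) (hq : 0 < q)
    {z w : ℕ → ℝ} (hz : ∀ n, 0 < z n) (hw : ∀ n, 0 < w n)
    (hrec : ∀ n, z (n + 1) * (q * w n + z n) = L * (K - 1) + K * q * w n + z n) :
    (∀ᶠ n in atTop, z n ∈ Icc (min K L) (max K L)) ∨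
      (min K L = max K L ∧ Tendsto z atTop (𝓝 (min K L))) := by
  have hden : ∀ n, 0 < q * w n + z n := fun n => by
    have := hz n; have := hw n; positivity
  have eqK : ∀ n, (z (n + 1) - K) * (q * w n + z n) = (K - 1) * (L - z n) := fun n => by
    linear_combination hrec n
  have eqL : ∀ n, (z (n + 1) - L) * (q * w n + z n) =
      (K - 1) * L - (L - 1) * z n - (L - K) * (q * w n) := fun n => by
    linear_combination hrec n
  have geK : ∀ n, z n ≤ L → K ≤ z (n + 1) := fun n h => by
    have := eqK n
    by_contra! h'
    nlinarith [mul_pos (sub_pos.2 h') (hden n), mul_nonneg (sub_pos.2 hK).le (sub_nonneg.2 h)]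
  have leK : ∀ n, L ≤ z n → z (n + 1) ≤ K := fun n h => by
    have := eqK n
    by_contra! h'
    nlinarith [mul_pos (sub_pos.2 h') (hden n), mul_nonneg (sub_pos.2 hK).le (sub_nonneg.2 h)]
  have hqw : ∀ n, 0 < q * w n := fun n => mul_pos hq (hw n)
  refine eventually_mem_Icc_or_tendsto (δ := 1 / K) min_le_max (by positivity) ?_ ?_ ?_ ?_
  · intro n hn
    rcases le_total K L with hKL | hKL
    · rw [min_eq_left hKL, max_eq_right hKL] at hn ⊢
      refine ⟨geK n hn.2, ?_⟩
      by_contra! h'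
      nlinarith [eqL n, mul_pos (sub_pos.2 h') (hden n),
        mul_nonneg (sub_nonneg.2 hKL) (hqw n).le,
        mul_nonneg (show 0 ≤ L - 1 by linarith) (sub_nonneg.2 hn.1)]
    · rw [min_eq_right hKL, max_eq_left hKL] at hn ⊢
      refine ⟨?_, leK n hn.1⟩
      by_contra! h'
      have h1 : (L - 1) * z n ≤ (K - 1) * L := by
        nlinarith [mul_nonneg hL (sub_nonneg.2 hn.2), hn.1]
      nlinarith [eqL n, mul_pos (sub_pos.2 h') (hden n),
        mul_nonneg (sub_nonneg.2 hKL) (hqw n).le]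
  · intro n hn
    exact (min_le_left _ _).trans (geK n (hn.le.trans (min_le_right _ _)))
  · intro n hn
    exact (leK n ((le_max_right _ _).trans hn.le)).trans (le_max_left _ _)
  · intro n h0 h1 h2
    have hlK : z (n + 1) < K := h1.trans_le (min_le_left _ _)
    have hhK : K < z (n + 2) := (le_max_left _ _).trans_lt h2
    have hhl : z (n + 1) < z n := h1.trans (min_le_max.trans_lt h0)
    have e0 : L * (K - 1) + z n < z n * z (n + 1) := by
      nlinarith [hrec n, mul_pos (hqw n) (sub_pos.2 hlK)]
    have e1 : z (n + 2) * z (n + 1) < L * (K - 1) + z (n + 1) := by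
      nlinarith [hrec (n + 1), mul_pos (hqw (n + 1)) (sub_pos.2 hhK)]
    have e2 : z n - z (n + 1) < (z n - z (n + 2)) * z (n + 1) := by linarith
    have hpos : 0 < z n - z (n + 2) := by
      by_contra! h
      nlinarith [mul_nonneg (sub_nonneg.2 h) (hz (n + 1)).le]
    rw [one_div, inv_mul_le_iff₀ (by positivity)]
    nlinarith [mul_pos hpos (sub_pos.2 hlK)]

/-- With `r = (q - p) * c`, where `p < q`, a solution is eventually between `1` and `c`, or `c = 1`
is its limit. -/
theorem solution_trapped {p q c : ℝ} (hp : 0 < p) (hpq : p < q) (hc : 0 ≤ c)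
    {x : ℕ → ℝ} (hx : ∀ n, 0 < x n)
    (hrec : ∀ n, x (n + 2) * (q * x (n + 1) + x n) = (q - p) * c + p * x (n + 1) + x n) :
    (∀ᶠ n in atTop, x n ∈ Icc (min 1 c) (max 1 c)) ∨
      (min 1 c = max 1 c ∧ Tendsto x atTop (𝓝 (min 1 c))) := by
  have hq : 0 < q := hp.trans hpq
  have hden : ∀ n, 0 < q * x (n + 1) + x n := fun n => by
    have := hx n; have := hx (n + 1); positivity
  have eq1 : ∀ n, (x (n + 2) - 1) * (q * x (n + 1) + x n) = (q - p) * (c - x (n + 1)) :=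
    fun n => by linear_combination hrec n
  have eqc : ∀ n, (x (n + 2) - c) * (q * x (n + 1) + x n) =
      (q - p) * c - (c * q - p) * x (n + 1) - (c - 1) * x n := fun n => by
    linear_combination hrec n
  have ge1 : ∀ n, x (n + 1) ≤ c → 1 ≤ x (n + 2) := fun n h => by
    have := eq1 n
    by_contra! h'
    nlinarith [mul_pos (sub_pos.2 h') (hden n), mul_nonneg (sub_pos.2 hpq).le (sub_nonneg.2 h)]
  have le1 : ∀ n, c ≤ x (n + 1) → x (n + 2) ≤ 1 := fun n h => by
    have := eq1 n
    by_contra! h'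
    nlinarith [mul_pos (sub_pos.2 h') (hden n), mul_nonneg (sub_pos.2 hpq).le (sub_nonneg.2 h)]
  have key := eventually_mem_Icc_or_tendsto (z := fun n => x (n + 1)) (δ := p / q)
    (min_le_max (a := 1) (b := c)) (by positivity) ?_ ?_ ?_ ?_
  · refine key.imp (fun h => ?_) (fun h => ⟨h.1, (tendsto_add_atTop_iff_nat 1).1 h.2⟩)
    obtain ⟨N, hN⟩ := eventually_atTop.1 h
    refine eventually_atTop.2 ⟨N + 1, fun n hn => ?_⟩
    obtain ⟨k, rfl⟩ := Nat.exists_eq_add_of_le' (show 1 ≤ n by omega)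
    exact hN k (by omega)
  · intro n hn
    rcases le_total 1 c with h1c | h1c
    · simp only [min_eq_left h1c, max_eq_right h1c] at hn ⊢
      refine ⟨ge1 n hn.2, ?_⟩
      by_contra! h'
      have h2 : (q - p) * c ≤ (c * q - p) * x (n + 1) := by
        nlinarith [mul_nonneg (show 0 ≤ c * q - p by nlinarith) (sub_nonneg.2 hn.1)]
      nlinarith [eqc n, mul_pos (sub_pos.2 h') (hden n), mul_nonneg (sub_nonneg.2 h1c) (hx n).le]
    · simp only [min_eq_right h1c, max_eq_left h1c] at hn ⊢
      refine ⟨?_, le1 n hn.1⟩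
      by_contra! h'
      have h2 : (c * q - p) * x (n + 1) ≤ (q - p) * c := by
        nlinarith [mul_nonneg (mul_nonneg hc hq.le) (sub_nonneg.2 hn.2),
          mul_nonneg hp.le (sub_nonneg.2 hn.1)]
      nlinarith [eqc n, mul_pos (sub_pos.2 h') (hden n), mul_nonneg (sub_nonneg.2 h1c) (hx n).le]
  · intro n hn
    exact (min_le_left _ _).trans (ge1 n (hn.le.trans (min_le_right _ _)))
  · intro n hn
    exact (le1 n ((le_max_right _ _).trans hn.le)).trans (le_max_left _ _)
  · intro n h0 h1 h2
    have hl1 : x (n + 2) < 1 := h1.trans_le (min_le_left _ _)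
    have hh1 : 1 < x (n + 3) := (le_max_left _ _).trans_lt h2
    have hhl : x (n + 2) < x (n + 1) := h1.trans (min_le_max.trans_lt h0)
    have e0 : (q - p) * c + p * x (n + 1) < q * x (n + 2) * x (n + 1) := by
      nlinarith [hrec n, mul_pos (hx n) (sub_pos.2 hl1)]
    have e1 : q * x (n + 2) * x (n + 3) < (q - p) * c + p * x (n + 2) := by
      nlinarith [hrec (n + 1), mul_pos (hx (n + 1)) (sub_pos.2 hh1)]
    have e2 : p * (x (n + 1) - x (n + 2)) < q * x (n + 2) * (x (n + 1) - x (n + 3)) := by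
      linarith
    have hpos : 0 < x (n + 1) - x (n + 3) := by
      by_contra! h
      nlinarith [mul_nonneg (mul_pos hq (hx (n + 2))).le (sub_nonneg.2 h),
        mul_pos hp (sub_pos.2 hhl)]
    change p / q * (x (n + 1) - x (n + 2)) ≤ x (n + 1) - x (n + 3)
    rw [div_mul_eq_mul_div, div_le_iff₀ hq]
    nlinarith [mul_pos (mul_pos hq hpos) (sub_pos.2 hl1)]

/-- Proposition (existence of an invariant and attracting interval for
Eq. (3-2) with `p, q > 0`, `r ≥ 0`): either every positive solution converges
to the equilibrium, or there is an invariant, attracting interval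
`[m*, M*] ⊆ (0, ∞)` on whose square the associated function is coordinate-wise
strictly monotonic. Here `x 0` plays the role of `x_{-1}` and `x 1` of `x_0`. -/
theorem stmt_5 (p q r : ℝ) (hp : 0 < p) (hq : 0 < q) (hr : 0 ≤ r)
    (f : ℝ → ℝ → ℝ) (hf : ∀ x y : ℝ, f x y = (r + p * x + y) / (q * x + y))
    (ybar : ℝ)
    (hybar : ybar = (p + 1 + Real.sqrt ((p + 1) ^ 2 + 4 * r * (q + 1))) / (2 * (q + 1))) :
    (∀ x : ℕ → ℝ, (∀ n : ℕ, 0 < x n) →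
        (∀ n : ℕ, x (n + 2) = f (x (n + 1)) (x n)) →
        Tendsto x atTop (nhds ybar)) ∨
    (∃ m M : ℝ, 0 < m ∧ m < M ∧
      (∀ x ∈ Icc m M, ∀ y ∈ Icc m M, f x y ∈ Icc m M) ∧
      (∀ x : ℕ → ℝ, (∀ n : ℕ, 0 < x n) →
        (∀ n : ℕ, x (n + 2) = f (x (n + 1)) (x n)) →
        ∃ N : ℕ, ∀ n ≥ N, x n ∈ Icc m M) ∧
      ((∀ y ∈ Icc m M, StrictMonoOn (fun x => f x y) (Icc m M)) ∨
       (∀ y ∈ Icc m M, StrictAntiOn (fun x => f x y) (Icc m M))) ∧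
      ((∀ x ∈ Icc m M, StrictMonoOn (fun y => f x y) (Icc m M)) ∨
       (∀ x ∈ Icc m M, StrictAntiOn (fun y => f x y) (Icc m M)))) := by
  have hmul : ∀ x : ℕ → ℝ, (∀ n : ℕ, 0 < x n) → (∀ n : ℕ, x (n + 2) = f (x (n + 1)) (x n)) →
      ∀ n, x (n + 2) * (q * x (n + 1) + x n) = r + p * x (n + 1) + x n := fun x hx h n => by
    have := hx n
    have := hx (n + 1)
    rw [h, hf, div_mul_cancel₀]
    positivity
  have hq1 : 0 < 2 * (q + 1) := by positivity
  rcases lt_trichotomy p q with hpq | rfl | hpq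
  · have hqp := sub_pos.2 hpq
    obtain ⟨c, hc, rfl⟩ : ∃ c, 0 ≤ c ∧ r = (q - p) * c :=
      ⟨r / (q - p), by positivity, by field_simp⟩
    have trap := fun x hx h => solution_trapped hp hpq hc hx (hmul x hx h)
    have anti : ∀ m M : ℝ, 0 < m →
        ∀ y ∈ Icc m M, StrictAntiOn (fun x => f x y) (Icc m M) := fun m M hm =>
      linFrac_strictAntiOn_left hf hq hm fun y hy => by
        nlinarith [mul_pos hqp (hm.trans_le hy.1), mul_nonneg hq.le (mul_nonneg hqp.le hc)]
    rcases lt_trichotomy c 1 with h | rfl | h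
    · right
      simp only [min_eq_right h.le, max_eq_left h.le] at trap
      have hm : c < f 1 c := by
        rw [hf, lt_div_iff₀ (by positivity)]
        nlinarith [mul_pos hp (sub_pos.2 h), mul_nonneg hc (sub_pos.2 h).le]
      have hM : f 1 c < 1 := by
        rw [hf, div_lt_one (by positivity)]
        nlinarith [mul_pos hqp (sub_pos.2 h)]
      have hm0 := hc.trans_lt hm
      have hmap : ∀ x y, 0 < x → 0 < y → x ∈ Icc c 1 → y ∈ Icc c 1 →
          f x y ∈ Icc (f 1 c) 1 := by
        intro x y hx hy hxI hyI
        constructor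
        · refine (linFrac_le_left hf (x₂ := x) (by positivity) (by positivity) ?_).trans
            (linFrac_le_right hf (by positivity) (by positivity) ?_)
          · have h2 : 0 ≤ (q - p) * c + q * ((q - p) * c) := by positivity
            nlinarith [mul_nonneg (sub_nonneg.2 hxI.2) h2]
          · nlinarith [mul_nonneg (sub_nonneg.2 hyI.1)
              (mul_nonneg hqp.le (sub_nonneg.2 hxI.1))]
        · rw [hf, div_le_one (by positivity)]
          nlinarith [mul_nonneg hqp.le (sub_nonneg.2 hxI.1)]
      obtain ⟨inv, attr⟩ := invariant_and_attracting (f := f) hm0 hm.le le_rfl hmap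
        (fun x hx hrec => (trap x hx hrec).resolve_right fun h' => h.ne h'.1)
      exact ⟨f 1 c, 1, hm0, hM, inv, attr, .inr (anti _ _ hm0),
        .inl (linFrac_strictMonoOn_right hf hq hm0 fun x hx => by
          nlinarith [mul_pos hqp (sub_pos.2 (hm.trans_le hx.1))])⟩
    · left
      intro x hx hrec
      have hy : ybar = 1 := by
        rw [hybar, show (p + 1) ^ 2 + 4 * ((q - p) * 1) * (q + 1) = (2 * q + 1 - p) ^ 2 by ring,
          Real.sqrt_sq (by linarith), div_eq_iff hq1.ne']
        ring
      rw [hy]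
      have := trap x hx hrec
      simp only [min_self, max_self, true_and] at this
      exact tendsto_of_eventually_mem_Icc_or_tendsto this
    · right
      simp only [min_eq_left h.le, max_eq_right h.le] at trap
      have hM : f 1 1 < c := by
        rw [hf, div_lt_iff₀ (by positivity)]
        nlinarith [mul_pos hp (sub_pos.2 h)]
      have hm : 1 < f 1 1 := by
        rw [hf, one_lt_div (by positivity)]
        nlinarith [mul_pos hqp (sub_pos.2 h)]
      have hmap : ∀ x y, 0 < x → 0 < y → x ∈ Icc 1 c → y ∈ Icc 1 c →
          f x y ∈ Icc 1 (f 1 1) := by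
        intro x y hx hy hxI hyI
        constructor
        · rw [hf, one_le_div (by positivity)]
          nlinarith [mul_nonneg hqp.le (sub_nonneg.2 hxI.2)]
        · refine (linFrac_le_left hf (x₂ := 1) (by positivity) (by positivity) ?_).trans
            (linFrac_le_right hf (by positivity) (by positivity) ?_)
          · have h2 : 0 ≤ (q - p) * y + q * ((q - p) * c) := by positivity
            nlinarith [mul_nonneg (sub_nonneg.2 hxI.1) h2]
          · nlinarith [mul_nonneg (sub_nonneg.2 hyI.1) (mul_nonneg hqp.le (sub_pos.2 h).le)]
      obtain ⟨inv, attr⟩ := invariant_and_attracting (f := f) one_pos le_rfl hM.le hmap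
        (fun x hx hrec => (trap x hx hrec).resolve_right fun h' => h.ne h'.1)
      exact ⟨1, f 1 1, one_pos, hm, inv, attr, .inr (anti _ _ one_pos),
        .inr (linFrac_strictAntiOn_right hf hq one_pos fun x hx => by
          nlinarith [mul_pos hqp (sub_pos.2 (hx.2.trans_lt hM))])⟩
  · rcases hr.eq_or_lt with rfl | hr
    · left
      intro x hx hrec
      have hy : ybar = 1 := by
        rw [hybar, show (p + 1) ^ 2 + 4 * 0 * (p + 1) = (p + 1) ^ 2 by ring,
          Real.sqrt_sq (by linarith), div_eq_iff hq1.ne']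
        ring
      rw [hy]
      refine (tendsto_add_atTop_iff_nat 2).1 (tendsto_const_nhds.congr fun n => ?_)
      have := hx n
      have := hx (n + 1)
      rw [hrec, hf, zero_add, div_self (by positivity)]
    · right
      have lower : ∀ x y, 0 < x → 0 < y → 1 ≤ f x y := fun x y hx hy => by
        rw [hf, one_le_div (by positivity)]
        linarith
      have upper : ∀ x y, 1 ≤ x → 1 ≤ y → f x y ≤ f 1 1 := fun x y hx hy => by
        refine (linFrac_le_left hf (x₂ := 1) (by positivity) (by positivity) ?_).trans
            (linFrac_le_right hf (by positivity) (by positivity) ?_)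
        · nlinarith [mul_nonneg (sub_nonneg.2 hx) (mul_pos hp hr).le]
        · nlinarith [mul_nonneg (sub_nonneg.2 hy) hr.le]
      have hm : 1 < f 1 1 := by
        rw [hf, one_lt_div (by positivity)]
        linarith
      refine ⟨1, f 1 1, one_pos, hm, fun x hx y hy => ⟨lower x y (one_pos.trans_le hx.1)
        (one_pos.trans_le hy.1), upper x y hx.1 hy.1⟩, fun x hx hrec => ⟨4, fun n hn => ?_⟩,
        .inr (linFrac_strictAntiOn_left hf hq one_pos fun y _ => by nlinarith [mul_pos hp hr]),
        .inr (linFrac_strictAntiOn_right hf hq one_pos fun x _ => by nlinarith)⟩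
      have ge1 : ∀ k, 1 ≤ x (k + 2) := fun k => by
        rw [hrec]
        exact lower _ _ (hx _) (hx _)
      obtain ⟨k, rfl⟩ := Nat.exists_eq_add_of_le' hn
      refine ⟨ge1 (k + 2), ?_⟩
      rw [show k + 4 = k + 2 + 2 by ring, hrec]
      exact upper _ _ (ge1 (k + 1)) (ge1 k)
  · obtain ⟨K, hK, rfl⟩ : ∃ K, 1 < K ∧ p = K * q :=
      ⟨p / q, (one_lt_div hq).2 hpq, by field_simp⟩
    have hK1 := sub_pos.2 hK
    have hK0 := one_pos.trans hK
    obtain ⟨L, hL, rfl⟩ : ∃ L, 0 ≤ L ∧ r = L * (K - 1) :=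
      ⟨r / (K - 1), by positivity, by field_simp⟩
    have trap₀ : ∀ x : ℕ → ℝ, (∀ n, 0 < x n) → (∀ n, x (n + 2) = f (x (n + 1)) (x n)) → _ :=
      fun x hx h => every_other_term_trapped hK hL hq (z := fun k => x (2 * k))
        (w := fun k => x (2 * k + 1)) (fun k => hx _) (fun k => hx _)
        (fun k => hmul x hx h (2 * k))
    have trap₁ : ∀ x : ℕ → ℝ, (∀ n, 0 < x n) → (∀ n, x (n + 2) = f (x (n + 1)) (x n)) → _ :=
      fun x hx h => every_other_term_trapped hK hL hq (z := fun k => x (2 * k + 1))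
        (w := fun k => x (2 * k + 2)) (fun k => hx _) (fun k => hx _)
        (fun k => hmul x hx h (2 * k + 1))
    have anti : ∀ m M : ℝ, 0 < m →
        ∀ x ∈ Icc m M, StrictAntiOn (fun y => f x y) (Icc m M) := fun m M hm =>
      linFrac_strictAntiOn_right hf hq hm fun x hx => by
        nlinarith [mul_pos hK1 (mul_pos hq (hm.trans_le hx.1)), mul_nonneg hL hK1.le]
    rcases lt_trichotomy L K with h | rfl | h
    · right
      simp only [min_eq_right h.le, max_eq_left h.le] at trap₀ trap₁
      have hm : L < f L K := by
        rw [hf, lt_div_iff₀ (by positivity)]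
        nlinarith [mul_nonneg (mul_nonneg hq.le hL) (sub_pos.2 h).le]
      have hM : f L K < K := by
        rw [hf, div_lt_iff₀ (by positivity)]
        nlinarith [mul_pos hK1 (sub_pos.2 h)]
      have hm0 := hL.trans_lt hm
      have hmap : ∀ x y, 0 < x → 0 < y → x ∈ Icc L K → y ∈ Icc L K →
          f x y ∈ Icc (f L K) K := by
        intro x y hx hy hxI hyI
        constructor
        · refine (linFrac_le_left hf (x₂ := x) (by positivity) (by positivity) ?_).trans
            (linFrac_le_right hf (by positivity) (by positivity) ?_)
          · nlinarith [mul_nonneg (sub_nonneg.2 hxI.1)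
              (mul_nonneg (mul_pos hq hK1).le (sub_pos.2 h).le)]
          · have h2 : 0 ≤ (K - 1) * (q * x + L) := by positivity
            nlinarith [mul_nonneg (sub_nonneg.2 hyI.2) h2]
        · rw [hf, div_le_iff₀ (by positivity)]
          nlinarith [mul_nonneg hK1.le (sub_nonneg.2 hyI.1)]
      obtain ⟨inv, attr⟩ := invariant_and_attracting (f := f) hm0 hm.le le_rfl hmap
        (fun x hx hrec => eventually_atTop_of_even_odd
          ((trap₀ x hx hrec).resolve_right fun h' => h.ne h'.1)
          ((trap₁ x hx hrec).resolve_right fun h' => h.ne h'.1))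
      exact ⟨f L K, K, hm0, hM, inv, attr,
        .inl (linFrac_strictMonoOn_left hf hq hm0 fun y hy => by
          nlinarith [mul_pos (mul_pos hq hK1) (sub_pos.2 (hm.trans_le hy.1))]),
        .inr (anti _ _ hm0)⟩
    · left
      intro x hx hrec
      have hy : ybar = L := by
        rw [hybar, show (L * q + 1) ^ 2 + 4 * (L * (L - 1)) * (q + 1) =
          (L * q + 2 * L - 1) ^ 2 by ring, Real.sqrt_sq (by nlinarith), div_eq_iff hq1.ne']
        ring
      rw [hy]
      have h₀ := trap₀ x hx hrec
      have h₁ := trap₁ x hx hrec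
      simp only [min_self, max_self, true_and] at h₀ h₁
      exact tendsto_atTop_of_even_odd (tendsto_of_eventually_mem_Icc_or_tendsto h₀)
        (tendsto_of_eventually_mem_Icc_or_tendsto h₁)
    · right
      simp only [min_eq_left h.le, max_eq_right h.le] at trap₀ trap₁
      have hM : f K K < L := by
        rw [hf, div_lt_iff₀ (by positivity)]
        nlinarith [mul_pos (mul_pos hq hK0) (sub_pos.2 h)]
      have hm : K < f K K := by
        rw [hf, lt_div_iff₀ (by positivity)]
        nlinarith [mul_pos hK1 (sub_pos.2 h)]
      have hmap : ∀ x y, 0 < x → 0 < y → x ∈ Icc K L → y ∈ Icc K L →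
          f x y ∈ Icc K (f K K) := by
        intro x y hx hy hxI hyI
        constructor
        · rw [hf, le_div_iff₀ (by positivity)]
          nlinarith [mul_nonneg hK1.le (sub_nonneg.2 hyI.2)]
        · refine (linFrac_le_left hf (x₂ := K) (by positivity) (by positivity) ?_).trans
            (linFrac_le_right hf (by positivity) (by positivity) ?_)
          · nlinarith [mul_nonneg (sub_nonneg.2 hxI.1)
              (mul_nonneg (mul_pos hq hK1).le (sub_nonneg.2 hyI.2))]
          · have h2 : 0 ≤ (K - 1) * (q * K + L) := by positivity
            nlinarith [mul_nonneg (sub_nonneg.2 hyI.1) h2]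
      obtain ⟨inv, attr⟩ := invariant_and_attracting (f := f) hK0 le_rfl hM.le hmap
        (fun x hx hrec => eventually_atTop_of_even_odd
          ((trap₀ x hx hrec).resolve_right fun h' => h.ne h'.1)
          ((trap₁ x hx hrec).resolve_right fun h' => h.ne h'.1))
      exact ⟨K, f K K, hK0, hm, inv, attr,
        .inr (linFrac_strictAntiOn_left hf hq hK0 fun y hy => by
          nlinarith [mul_pos (mul_pos hq hK1) (sub_pos.2 (hy.2.trans_lt hM))]),
        .inr (anti _ _ hK0)⟩
end

section
/- Let α, β, γ, A, B, C be positive real numbers satisfying β·C = B·γ. Then every sequence (x_n)_{n≥-1} with x_{-1}, x_0 ∈ [0,∞) satisfying x_{n+1} = (α + β·x_n + γ·x_{n-1})/(A + B·x_n + C·x_{n-1}) for all n ≥ 0 converges to the unique positive equilibrium x̄, the unique positive root of (B+C)x² + (A−β−γ)x − α = 0. -/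
open Filter Topology Set

/-- The Möbius map `u ↦ (α + k u) / (A + u)` contracts `|u - v| / (u + v)` by the factor
`|α - k A| / (α + k A)`. -/
theorem abs_moebius_sub_le {α k A u v : ℝ} (hα : 0 < α) (hk : 0 < k) (hA : 0 < A)
    (hu : 0 ≤ u) (hv : 0 < v) {t : ℝ} (ht : |u - v| ≤ t * (u + v)) :
    |(α + k * u) / (A + u) - (α + k * v) / (A + v)| ≤
      |α - k * A| / (α + k * A) * t * ((α + k * u) / (A + u) + (α + k * v) / (A + v)) := by
  have hAu : 0 < A + u := by linarith
  have hAv : 0 < A + v := by linarith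
  have hs : 0 < α + k * A := by positivity
  have ht0 : 0 ≤ t := by
    by_contra! h
    nlinarith [abs_nonneg (u - v)]
  have hdiff : (α + k * u) / (A + u) - (α + k * v) / (A + v) =
      (α - k * A) * (v - u) / ((A + u) * (A + v)) := by
    field_simp
    ring
  have hsum : (α + k * u) / (A + u) + (α + k * v) / (A + v) =
      ((α + k * A) * (u + v) + 2 * (α * A + k * (u * v))) / ((A + u) * (A + v)) := by
    field_simp
    ring
  rw [hdiff, hsum, abs_div, abs_mul, abs_sub_comm v u, abs_of_pos (mul_pos hAu hAv),
    ← mul_div_assoc]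
  refine div_le_div_of_nonneg_right ?_ (mul_pos hAu hAv).le
  calc |α - k * A| * |u - v| ≤ |α - k * A| * (t * (u + v)) := by gcongr
    _ = |α - k * A| / (α + k * A) * t * ((α + k * A) * (u + v)) := by field_simp
    _ ≤ _ := by
        gcongr
        have : 0 ≤ α * A + k * (u * v) := by positivity
        linarith

/-- Lemma (case `p = q`, i.e. `β·C = B·γ`): every solution to Eq. (3-3)
converges to the unique positive equilibrium.
Here `x 0` plays the role of `x_{-1}` and `x 1` of `x_0`. -/
theorem stmt_6 (α β γ A B C : ℝ)
    (hα : 0 < α) (hβ : 0 < β) (hγ : 0 < γ) (hA : 0 < A) (hB : 0 < B) (hC : 0 < C)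
    (hpq : β * C = B * γ)
    (x : ℕ → ℝ) (hx0 : 0 ≤ x 0) (hx1 : 0 ≤ x 1)
    (hrec : ∀ n : ℕ, x (n + 2) =
      (α + β * x (n + 1) + γ * x n) / (A + B * x (n + 1) + C * x n))
    (xbar : ℝ) (hxbar_pos : 0 < xbar)
    (hxbar_eq : (B + C) * xbar ^ 2 + (A - β - γ) * xbar - α = 0) :
    Tendsto x atTop (nhds xbar) := by
  obtain ⟨k, rfl⟩ : ∃ k, β = k * B := ⟨β / B, by field_simp⟩
  obtain rfl : γ = k * C := mul_left_cancel₀ hB.ne' (by linarith)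
  have hk : 0 < k := pos_of_mul_pos_left hβ hB.le
  have hnonneg : ∀ n, 0 ≤ x n ∧ 0 ≤ x (n + 1) := by
    intro n
    induction n with
    | zero => exact ⟨hx0, hx1⟩
    | succ n ih =>
      obtain ⟨h0, h1⟩ := ih
      refine ⟨h1, ?_⟩
      rw [hrec n]
      positivity
  have hrec' : ∀ n, x (n + 2) =
      (α + k * (B * x (n + 1) + C * x n)) / (A + (B * x (n + 1) + C * x n)) := by
    intro n
    rw [hrec n]
    congr 1 <;> ring
  have hfix : (α + k * ((B + C) * xbar)) / (A + (B + C) * xbar) = xbar := by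
    rw [div_eq_iff (by positivity)]
    linarith
  set c := |α - k * A| / (α + k * A) with hc
  have hc0 : 0 ≤ c := by positivity
  have hkA : 0 < k * A := mul_pos hk hA
  have hc1 : c < 1 := by
    rw [hc, div_lt_one (by positivity), abs_lt]
    constructor <;> linarith
  have hstep : ∀ n t, |x n - xbar| ≤ t * (x n + xbar) →
      |x (n + 1) - xbar| ≤ t * (x (n + 1) + xbar) →
      |x (n + 2) - xbar| ≤ c * t * (x (n + 2) + xbar) := by
    intro n t h0 h1
    obtain ⟨hn0, hn1⟩ := hnonneg n
    have hu : 0 ≤ B * x (n + 1) + C * x n := by positivity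
    have key := abs_moebius_sub_le (v := (B + C) * xbar) (t := t) hα hk hA hu (by positivity) (by
      rw [abs_le] at h0 h1 ⊢
      constructor <;> nlinarith)
    rwa [hfix, ← hrec' n] at key
  have hgeom : ∀ j n, 2 * j ≤ n → |x n - xbar| ≤ c ^ j * (x n + xbar) := by
    intro j
    induction j with
    | zero =>
      intro n _
      have := (hnonneg n).1
      rw [abs_le]
      constructor <;> linarith
    | succ j ih =>
      intro n hn
      obtain ⟨m, rfl⟩ : ∃ m, n = m + 2 := ⟨n - 2, by lia⟩
      rw [pow_succ']
      exact hstep m _ (ih m (by lia)) (ih (m + 1) (by lia))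
  have hbdd : ∀ n, x (n + 2) ≤ α / A + k := by
    intro n
    obtain ⟨hn0, hn1⟩ := hnonneg n
    have hu : 0 ≤ B * x (n + 1) + C * x n := by positivity
    rw [hrec' n, div_le_iff₀ (by positivity)]
    have h : α / A * A = α := by field_simp
    have : 0 ≤ α / A * (B * x (n + 1) + C * x n) := by positivity
    nlinarith
  rw [← tendsto_add_atTop_iff_nat 2, tendsto_iff_dist_tendsto_zero]
  have hlim : Tendsto (fun n : ℕ => c ^ (n / 2) * (α / A + k + xbar)) atTop (𝓝 0) := by
    simpa using ((tendsto_pow_atTop_nhds_zero_of_lt_one hc0 hc1).comp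
      (Nat.tendsto_div_const_atTop two_ne_zero)).mul_const (α / A + k + xbar)
  refine squeeze_zero (fun _ => dist_nonneg) (fun n => ?_) hlim
  rw [Real.dist_eq]
  refine (hgeom (n / 2) (n + 2) (by lia)).trans ?_
  gcongr
  exact hbdd n
end

section
/- Let p, q, r be real numbers with p > q > 0, r ≥ 0, and q·r/(p−q) < p/q. Set f(x,y) = (r + p·x + y)/(q·x + y), and let m̃, M̃ be reals with q·r/(p−q) < m̃ ≤ M̃ < p/q such that f(x,y) ∈ [m̃, M̃] for all x, y ∈ [m̃, M̃]. Then every sequence (x_n)_{n≥-1} with x_{-1}, x_0 ∈ [m̃, M̃] satisfying x_{n+1} = f(x_n, x_{n-1}) for all n ≥ 0 converges to the equilibrium ȳ = (p+1+√((p+1)² + 4r(q+1)))/(2(q+1)). -/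
open Filter Topology Set

/-- The concave quadratic whose reciprocal weights the Lyapunov function `energy`. -/
def weight (p q r x : ℝ) : ℝ := 2 * p * x - q * x ^ 2 - p - q * r

/-- A Lyapunov function for the recursion: up to a constant, the invariant of the integrable map
obtained by symmetrizing the relation `z (q y + x) = r + p y + x` in `x` and `z`. -/
noncomputable def energy (p q r x y : ℝ) : ℝ :=
  (2 * (2 - q) * x * y + (2 - q) * q * (x ^ 2 + y ^ 2) + 2 * (p * q - 1) * (x + y)
    + (1 - 2 * p + (2 - q) * (p + q * r))) / (weight p q r x * weight p q r y)

lemma energy_sub_energy {p q r x y z : ℝ} (hx : weight p q r x ≠ 0) (hy : weight p q r y ≠ 0)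
    (hz : weight p q r z ≠ 0) (h : z * (q * y + x) = r + p * y + x) :
    energy p q r x y - energy p q r y z =
      q * ((2 - q) * y + 2 * p - 1) * (q * y + 1) * (x - z) ^ 2 /
        (weight p q r x * weight p q r y * weight p q r z) := by
  unfold energy
  rw [div_sub_div _ _ (mul_ne_zero hx hy) (mul_ne_zero hy hz),
    div_eq_div_iff (by positivity) (by positivity)]
  have key : (2 * (2 - q) * x * y + (2 - q) * q * (x ^ 2 + y ^ 2) + 2 * (p * q - 1) * (x + y)
        + (1 - 2 * p + (2 - q) * (p + q * r))) * weight p q r z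
      - weight p q r x * (2 * (2 - q) * y * z + (2 - q) * q * (y ^ 2 + z ^ 2)
        + 2 * (p * q - 1) * (y + z) + (1 - 2 * p + (2 - q) * (p + q * r)))
      = q * ((2 - q) * y + 2 * p - 1) * (q * y + 1) * (x - z) ^ 2 := by
    unfold weight
    linear_combination ((2 - q) * y + 2 * p - 1) * (2 * q * (x - z)) * h
  linear_combination weight p q r x * weight p q r y ^ 2 * weight p q r z * key

lemma weight_pos {p q r x : ℝ} (hq : 0 < q) (hpq : q < p) (hx1 : 1 < x)
    (hxl : q * r / (p - q) < x) (hxr : x < p / q) : 0 < weight p q r x := by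
  have hA : 0 < p - q := sub_pos.2 hpq
  set k := q * r / (p - q) with hk
  have hqr : q * r = k * (p - q) := by rw [hk]; field_simp
  rw [lt_div_iff₀ hq] at hxr
  have hw : weight p q r x = (p - q * x) * (x - 1) + (p - q) * (x - k) := by
    unfold weight; linear_combination -hqr
  rw [hw]
  have h1 : 0 < (p - q * x) * (x - 1) := mul_pos (by linarith) (by linarith)
  have h2 : 0 < (p - q) * (x - k) := mul_pos hA (by linarith)
  linarith

lemma weight_le {p q r x : ℝ} (hq : 0 < q) (hp : 0 < p) (hr : 0 ≤ r) :
    weight p q r x ≤ p ^ 2 / q := by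
  have h : p ^ 2 / q - weight p q r x = (p - q * x) ^ 2 / q + p + q * r := by
    unfold weight; field_simp; ring
  have : 0 ≤ (p - q * x) ^ 2 / q + p + q * r := by positivity
  linarith

lemma continuousOn_energy {p q r : ℝ} {s : Set ℝ} (hs : ∀ x ∈ s, 0 < weight p q r x) :
    ContinuousOn (fun v : ℝ × ℝ => energy p q r v.1 v.2) (s ×ˢ s) := by
  unfold energy
  refine ContinuousOn.div (by fun_prop) (by unfold weight; fun_prop) ?_
  rintro ⟨a, b⟩ ⟨ha, hb⟩
  exact (mul_pos (hs a ha) (hs b hb)).ne'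

/-- A solution on which `energy` decreases strictly is asymptotically two-periodic. -/
lemma tendsto_two_step_sub {p q r m M : ℝ} (hq : 0 < q) (hpq : q < p) (hr : 0 ≤ r)
    (hm1 : 1 < m) (hm : q * r / (p - q) < m) (hM : M < p / q)
    {x : ℕ → ℝ} (hx : ∀ n, x n ∈ Icc m M)
    (hrec : ∀ n, x (n + 2) * (q * x (n + 1) + x n) = r + p * x (n + 1) + x n) :
    Tendsto (fun n => x (n + 2) - x n) atTop (𝓝 0) := by
  have hp : 0 < p := hq.trans hpq
  have hw : ∀ t ∈ Icc m M, 0 < weight p q r t := fun t ht =>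
    weight_pos hq hpq (hm1.trans_le ht.1) (hm.trans_le ht.1) (ht.2.trans_lt hM)
  obtain ⟨c, hc, hlin⟩ : ∃ c > 0, ∀ t ∈ Icc m M, c ≤ (2 - q) * t + 2 * p - 1 := by
    refine ⟨min (2 * p + 1 - q) (2 * (p / q) + p - 1),
      lt_min (by linarith) ?_, fun t ht => ?_⟩
    · have : 1 < p / q := (one_lt_div hq).2 hpq
      linarith
    · rcases le_total q 2 with h | h
      · refine (min_le_left _ _).trans ?_
        nlinarith [ht.1]
      · refine (min_le_right _ _).trans ?_
        have h2 : q * (p / q) = p := by field_simp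
        nlinarith [ht.2]
  set V : ℕ → ℝ := fun n => energy p q r (x n) (x (n + 1)) with hV
  set C : ℝ := q * c / (p ^ 2 / q) ^ 3 with hC
  have hCpos : 0 < C := by positivity
  have hdrop : ∀ n, C * (x (n + 2) - x n) ^ 2 ≤ V n - V (n + 1) := by
    intro n
    have h0 := hw _ (hx n)
    have h1 := hw _ (hx (n + 1))
    have h2 := hw _ (hx (n + 2))
    have hpos : 0 < x (n + 1) := by linarith [(hx (n + 1)).1]
    have hl := hlin _ (hx (n + 1))
    have hE : V n - V (n + 1) = _ := energy_sub_energy h0.ne' h1.ne' h2.ne' (hrec n)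
    rw [hE, hC, div_mul_eq_mul_div]
    have hlpos : 0 < (2 - q) * x (n + 1) + 2 * p - 1 := hc.trans_le hl
    refine div_le_div₀ (mul_nonneg (mul_nonneg (mul_nonneg hq.le hlpos.le) (by positivity))
      (sq_nonneg _)) ?_ (mul_pos (mul_pos h0 h1) h2) ?_
    · have : q * c ≤ q * ((2 - q) * x (n + 1) + 2 * p - 1) * (q * x (n + 1) + 1) := by
        have h3 : 0 ≤ q * x (n + 1) := by positivity
        calc q * c ≤ q * ((2 - q) * x (n + 1) + 2 * p - 1) := by gcongr
          _ ≤ _ := le_mul_of_one_le_right (mul_nonneg hq.le hlpos.le) (by linarith)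
      calc q * c * (x (n + 2) - x n) ^ 2
          ≤ q * ((2 - q) * x (n + 1) + 2 * p - 1) * (q * x (n + 1) + 1)
              * (x (n + 2) - x n) ^ 2 := by gcongr
        _ = _ := by ring
    · calc weight p q r (x n) * weight p q r (x (n + 1)) * weight p q r (x (n + 2))
          ≤ p ^ 2 / q * (p ^ 2 / q) * (p ^ 2 / q) := by
            gcongr <;> exact weight_le hq hp hr
        _ = _ := by ring
  have hanti : Antitone V := antitone_nat_of_succ_le fun n => by
    have := hdrop n
    have : 0 ≤ C * (x (n + 2) - x n) ^ 2 := by positivity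
    linarith
  have hbdd : BddBelow (range V) := by
    refine ((isCompact_Icc.prod isCompact_Icc).bddBelow_image (continuousOn_energy hw)).mono ?_
    rintro _ ⟨n, rfl⟩
    exact ⟨(x n, x (n + 1)), ⟨hx n, hx (n + 1)⟩, rfl⟩
  have hlim := tendsto_atTop_ciInf hanti hbdd
  have hdiff : Tendsto (fun n => V n - V (n + 1)) atTop (𝓝 0) := by
    simpa using hlim.sub (hlim.comp (tendsto_add_atTop_nat 1))
  have hsq : Tendsto (fun n => (x (n + 2) - x n) ^ 2) atTop (𝓝 0) := by
    refine squeeze_zero (fun n => sq_nonneg _)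
      (fun n => (le_div_iff₀' hCpos).2 (hdrop n)) ?_
    simpa using hdiff.div_const C
  have := (Real.continuous_sqrt.tendsto 0).comp hsq
  simp only [Real.sqrt_zero, Function.comp_def, Real.sqrt_sq_eq_abs] at this
  exact (tendsto_zero_iff_abs_tendsto_zero _).2 this

lemma tendsto_zero_of_mul_of_le {u v : ℕ → ℝ} {c : ℝ} (hc : 0 < c) (hv : ∀ n, c ≤ v n)
    (h : Tendsto (fun n => u n * v n) atTop (𝓝 0)) : Tendsto u atTop (𝓝 0) := by
  refine squeeze_zero_norm (a := fun n => |u n * v n| / c) (fun n => ?_) ?_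
  · rw [Real.norm_eq_abs, le_div_iff₀ hc, abs_mul]
    gcongr
    exact (hv n).trans (le_abs_self _)
  · simpa using h.abs.div_const c

/-- A bounded solution that is asymptotically two-periodic and stays above `1` converges. -/
lemma tendsto_equilibrium {p q r M : ℝ} (hq : 0 < q) (hp : 0 < p) (hr : 0 ≤ r)
    {x : ℕ → ℝ} (hx1 : ∀ n, 1 < x n) (hxM : ∀ n, x n ≤ M)
    (hrec : ∀ n, x (n + 2) * (q * x (n + 1) + x n) = r + p * x (n + 1) + x n)
    (h : Tendsto (fun n => x (n + 2) - x n) atTop (𝓝 0)) :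
    Tendsto x atTop
      (𝓝 ((p + 1 + Real.sqrt ((p + 1) ^ 2 + 4 * r * (q + 1))) / (2 * (q + 1)))) := by
  have hmul : ∀ {u d : ℕ → ℝ} (B : ℝ), (∀ n, |u n| ≤ B) → Tendsto d atTop (𝓝 0) →
      Tendsto (fun n => u n * d n) atTop (𝓝 0) := fun B hu hd =>
    bdd_le_mul_tendsto_zero' B (Eventually.of_forall hu) hd
  have hden : ∀ n k, |q * x k + x n| ≤ q * M + M := fun n k => by
    have h0 : 0 < x k := by linarith [hx1 k]
    have h1 : 0 < x n := by linarith [hx1 n]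
    rw [abs_of_pos (by positivity)]
    have := hxM n
    have := mul_le_mul_of_nonneg_left (hxM k) hq.le
    linarith
  have hres : Tendsto (fun n => x n * (q * x (n + 1) + x n) - (r + p * x (n + 1) + x n))
      atTop (𝓝 0) := by
    have := (hmul _ (fun n => hden n (n + 1)) h).neg
    rw [neg_zero] at this
    refine this.congr fun n => ?_
    linear_combination -hrec n
  have hstep : Tendsto (fun n => x (n + 1) - x n) atTop (𝓝 0) := by
    have h1 := hres.comp (tendsto_add_atTop_nat 1)
    have h2 : Tendsto (fun n => (q * x (n + 1) - p) * (x (n + 2) - x n)) atTop (𝓝 0) := by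
      refine hmul (q * M + p) (fun n => ?_) h
      have h0 : 0 < x (n + 1) := by linarith [hx1 (n + 1)]
      have h3 : 0 < q * x (n + 1) := by positivity
      have := mul_le_mul_of_nonneg_left (hxM (n + 1)) hq.le
      rw [abs_le]
      constructor <;> linarith
    have h3 := (h1.sub h2).sub hres
    simp only [sub_zero, Function.comp_def] at h3
    refine tendsto_zero_of_mul_of_le (v := fun n => x (n + 1) + x n + (p - 1))
      (c := 1) one_pos (fun n => by linarith [hx1 n, hx1 (n + 1)]) (h3.congr fun n => ?_)
    ring
  have hquad : Tendsto (fun n => (q + 1) * x n ^ 2 - (p + 1) * x n - r) atTop (𝓝 0) := by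
    have h2 : Tendsto (fun n => (q * x n - p) * (x (n + 1) - x n)) atTop (𝓝 0) := by
      refine hmul (q * M + p) (fun n => ?_) hstep
      have h0 : 0 < x n := by linarith [hx1 n]
      have h3 : 0 < q * x n := by positivity
      have := mul_le_mul_of_nonneg_left (hxM n) hq.le
      rw [abs_le]
      constructor <;> linarith
    have h3 := hres.sub h2
    rw [sub_zero] at h3
    refine h3.congr fun n => ?_
    ring
  set s := Real.sqrt ((p + 1) ^ 2 + 4 * r * (q + 1)) with hs
  have hs2 : s ^ 2 = (p + 1) ^ 2 + 4 * r * (q + 1) := Real.sq_sqrt (by positivity)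
  have hsp : p + 1 ≤ s := Real.le_sqrt_of_sq_le (by nlinarith [mul_nonneg hr hq.le])
  rw [← tendsto_sub_nhds_zero_iff]
  refine tendsto_zero_of_mul_of_le (v := fun n => (q + 1) * x n + (s - (p + 1)) / 2)
    (c := q + 1) (by linarith) (fun n => by nlinarith [hx1 n]) (hquad.congr fun n => ?_)
  have hq1 : q + 1 ≠ 0 := by positivity
  field_simp
  linear_combination hs2

/-- Proposition: for `p > q > 0`, `r ≥ 0`, `qr/(p−q) < p/q`, every solution starting in a compact invariant interval `[m̃, M̃] ⊆ (qr/(p−q), p/q)` of Eq. (3-2) converges to the equilibrium.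
Here `x 0` plays the role of `x_{-1}` and `x 1` of `x_0`. -/
theorem stmt_7 (p q r : ℝ) (hq : 0 < q) (hpq : q < p) (hr : 0 ≤ r)
    (hcond : q * r / (p - q) < p / q)
    (mt Mt : ℝ) (hmt : q * r / (p - q) < mt) (hmM : mt ≤ Mt) (hMt : Mt < p / q)
    (hinv : ∀ x ∈ Icc mt Mt, ∀ y ∈ Icc mt Mt,
      (r + p * x + y) / (q * x + y) ∈ Icc mt Mt)
    (x : ℕ → ℝ) (hx0 : x 0 ∈ Icc mt Mt) (hx1 : x 1 ∈ Icc mt Mt)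
    (hrec : ∀ n : ℕ, x (n + 2) = (r + p * x (n + 1) + x n) / (q * x (n + 1) + x n)) :
    Tendsto x atTop
      (nhds ((p + 1 + Real.sqrt ((p + 1) ^ 2 + 4 * r * (q + 1))) / (2 * (q + 1)))) := by
  have hp : 0 < p := hq.trans hpq
  have hmt0 : 0 < mt := lt_of_le_of_lt (div_nonneg (by positivity) (by linarith)) hmt
  have hMt0 : 0 < Mt := hmt0.trans_le hmM
  have hmem : ∀ n, x n ∈ Icc mt Mt ∧ x (n + 1) ∈ Icc mt Mt := by
    intro n
    induction n with
    | zero => exact ⟨hx0, hx1⟩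
    | succ n ih => exact ⟨ih.2, hrec n ▸ hinv _ ih.2 _ ih.1⟩
  have hpos : ∀ n, 0 < x n := fun n => hmt0.trans_le (hmem n).1.1
  have hrec' : ∀ n, x (n + 2) * (q * x (n + 1) + x n) = r + p * x (n + 1) + x n := fun n => by
    have h0 := hpos n
    have h1 := hpos (n + 1)
    rw [hrec n, div_mul_cancel₀ _ (by positivity)]
  set e := (p - q) * mt / (q * Mt + Mt) with he
  have hepos : 0 < e := div_pos (mul_pos (by linarith) hmt0) (by positivity)
  have hlow : ∀ n, 1 + e ≤ x (n + 2) := fun n => by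
    have h0 := hpos n
    have h1 := hpos (n + 1)
    have hd : 0 < q * x (n + 1) + x n := by positivity
    have : x (n + 2) = 1 + ((p - q) * x (n + 1) + r) / (q * x (n + 1) + x n) := by
      rw [hrec n]
      field_simp
      ring
    rw [this, he]
    have hA : 0 < p - q := by linarith
    gcongr
    · have := mul_le_mul_of_nonneg_left (hmem n).2.1 hA.le
      linarith
    · exact (hmem n).2.2
    · exact (hmem n).1.2
  have htail : ∀ n, x (n + 2) ∈ Icc (max mt (1 + e)) Mt := fun n =>
    ⟨max_le (hmem (n + 2)).1.1 (hlow n), (hmem (n + 2)).1.2⟩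
  have h2 := tendsto_two_step_sub hq hpq hr (lt_max_of_lt_right (by linarith))
    (lt_max_of_lt_left hmt) hMt htail (fun n => hrec' (n + 2))
  refine (tendsto_add_atTop_iff_nat 2).1 ?_
  exact tendsto_equilibrium hq hp hr (fun n => by linarith [hlow n]) (fun n => (htail n).2)
    (fun n => hrec' (n + 2)) h2
end

section
/- Let p, q, r be real numbers with p > q > 0, r ≥ 0, and q·r/(p−q) < p/q, and suppose in addition that r ≤ p²·q − p. Set f(x,y) = (r + p·x + y)/(q·x + y), and let m̃, M̃ be reals with q·r/(p−q) < m̃ ≤ M̃ < p/q such that f(x,y) ∈ [m̃, M̃] for all x, y ∈ [m̃, M̃]. Then every sequence (x_n)_{n≥-1} with x_{-1}, x_0 ∈ [m̃, M̃] satisfying x_{n+1} = f(x_n, x_{n-1}) for all n ≥ 0 converges to the equilibrium ȳ = (p+1+√((p+1)² + 4r(q+1)))/(2(q+1)). -/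
open Filter Topology Set

/-- Nested-interval convergence for `y (n + 3) = g (y (n + 1)) (y n)` with `g` decreasing in both
arguments: it suffices that the diagonal map `t ↦ g t t` has no genuine two-cycle. -/
lemma exists_tendsto_of_antitone_of_no_two_cycle {a b : ℝ} {g : ℝ → ℝ → ℝ} {y : ℕ → ℝ}
    (hab : a ≤ b)
    (hmaps : ∀ u ∈ Icc a b, ∀ v ∈ Icc a b, g u v ∈ Icc a b)
    (hanti : ∀ u ∈ Icc a b, ∀ u' ∈ Icc a b, ∀ v ∈ Icc a b, ∀ v' ∈ Icc a b,
      u ≤ u' → v ≤ v' → g u' v' ≤ g u v)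
    (hcont : ContinuousOn (fun t => g t t) (Icc a b))
    (hcycle : ∀ m ∈ Icc a b, ∀ M ∈ Icc a b, g m m = M → g M M = m → m = M)
    (hy : ∀ n, y n ∈ Icc a b)
    (hrec : ∀ n, y (n + 3) = g (y (n + 1)) (y n)) :
    ∃ L ∈ Icc a b, Tendsto y atTop (𝓝 L) := by
  let F : ℝ × ℝ → ℝ × ℝ := fun c => (g c.2 c.2, g c.1 c.1)
  let c : ℕ → ℝ × ℝ := fun k => F^[k] (a, b)
  have hsucc : ∀ k, c (k + 1) = F (c k) := fun k => Function.iterate_succ_apply' F k _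
  have hlo : ∀ k, (c (k + 1)).1 = g (c k).2 (c k).2 := fun k => by rw [hsucc]
  have hhi : ∀ k, (c (k + 1)).2 = g (c k).1 (c k).1 := fun k => by rw [hsucc]
  have hmem : ∀ k, (c k).1 ∈ Icc a b ∧ (c k).2 ∈ Icc a b := by
    intro k
    induction k with
    | zero => exact ⟨left_mem_Icc.2 hab, right_mem_Icc.2 hab⟩
    | succ k ih =>
      rw [hlo, hhi]
      exact ⟨hmaps _ ih.2 _ ih.2, hmaps _ ih.1 _ ih.1⟩
  have hmono : ∀ k, (c k).1 ≤ (c (k + 1)).1 ∧ (c (k + 1)).2 ≤ (c k).2 := by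
    intro k
    induction k with
    | zero => exact ⟨(hmem 1).1.1, (hmem 1).2.2⟩
    | succ k ih =>
      rw [hlo (k + 1), hhi (k + 1), hlo k, hhi k]
      rw [hlo k, hhi k] at ih
      have h1 := hmem k
      have h2 := hmem (k + 1)
      rw [hlo k, hhi k] at h2
      exact ⟨hanti _ h2.2 _ h1.2 _ h2.2 _ h1.2 ih.2 ih.2,
        hanti _ h1.1 _ h2.1 _ h1.1 _ h2.1 ih.1 ih.1⟩
  have hev : ∀ k, ∀ᶠ n in atTop, y n ∈ Icc (c k).1 (c k).2 := by
    intro k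
    induction k with
    | zero => exact Eventually.of_forall hy
    | succ k ih =>
      obtain ⟨N, hN⟩ := eventually_atTop.1 ih
      refine eventually_atTop.2 ⟨N + 3, fun n hn => ?_⟩
      obtain ⟨j, rfl⟩ : ∃ j, n = j + 3 := ⟨n - 3, by omega⟩
      have h0 := hN j (by omega)
      have h1 := hN (j + 1) (by omega)
      rw [hrec, hlo, hhi]
      exact ⟨hanti _ (hy _) _ (hmem k).2 _ (hy _) _ (hmem k).2 h1.2 h0.2,
        hanti _ (hmem k).1 _ (hy _) _ (hmem k).1 _ (hy _) h1.1 h0.1⟩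
  have hm := tendsto_atTop_ciSup (monotone_nat_of_le_succ fun k => (hmono k).1)
    ⟨b, by rintro _ ⟨k, rfl⟩; exact (hmem k).1.2⟩
  have hM := tendsto_atTop_ciInf (antitone_nat_of_succ_le fun k => (hmono k).2)
    ⟨a, by rintro _ ⟨k, rfl⟩; exact (hmem k).2.1⟩
  set m := ⨆ k, (c k).1
  set M := ⨅ k, (c k).2
  have hmI : m ∈ Icc a b := isClosed_Icc.mem_of_tendsto hm (Eventually.of_forall fun k => (hmem k).1)
  have hMI : M ∈ Icc a b := isClosed_Icc.mem_of_tendsto hM (Eventually.of_forall fun k => (hmem k).2)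
  have e1 : g m m = M := by
    have h := (hcont m hmI).tendsto.comp (tendsto_nhdsWithin_iff.2
      ⟨hm, Eventually.of_forall fun k => (hmem k).1⟩)
    exact tendsto_nhds_unique (h.congr fun k => (hhi k).symm) ((tendsto_add_atTop_iff_nat 1).2 hM)
  have e2 : g M M = m := by
    have h := (hcont M hMI).tendsto.comp (tendsto_nhdsWithin_iff.2
      ⟨hM, Eventually.of_forall fun k => (hmem k).2⟩)
    exact tendsto_nhds_unique (h.congr fun k => (hlo k).symm) ((tendsto_add_atTop_iff_nat 1).2 hm)
  have hmM := hcycle m hmI M hMI e1 e2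
  refine ⟨m, hmI, tendsto_order.2 ⟨fun l hl => ?_, fun l hl => ?_⟩⟩
  · obtain ⟨k, hk⟩ := (hm.eventually (lt_mem_nhds hl)).exists
    exact (hev k).mono fun n hn => hk.trans_le hn.1
  · obtain ⟨k, hk⟩ := (hM.eventually (gt_mem_nhds (hmM ▸ hl))).exists
    exact (hev k).mono fun n hn => hn.2.trans_lt hk

/-- The map `f(x, y) = (r + p x + y) / (q x + y)`. -/
noncomputable def ratMap (p q r x y : ℝ) : ℝ := (r + p * x + y) / (q * x + y)

section ratMap

variable {p q r : ℝ}

lemma ratMap_pos (hq : 0 < q) (hpq : q < p) (hr : 0 ≤ r) {x y : ℝ} (hx : 0 < x) (hy : 0 < y) :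
    0 < ratMap p q r x y := by
  have hp := hq.trans hpq
  unfold ratMap
  positivity

lemma ratMap_le_ratMap_left (hq : 0 < q) {x x' y : ℝ} (hx : 0 < x) (hxx' : x ≤ x')
    (hy : 0 < y) (hqr : q * r ≤ (p - q) * y) : ratMap p q r x y ≤ ratMap p q r x' y := by
  have hx' := hx.trans_le hxx'
  unfold ratMap
  rw [div_le_div_iff₀ (by positivity) (by positivity)]
  nlinarith [mul_nonneg (sub_nonneg.2 hxx') (sub_nonneg.2 hqr)]

lemma ratMap_ratMap_eq (hq : 0 < q) {u v : ℝ} (hu : 0 < u) (hv : 0 < v) :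
    ratMap p q r (ratMap p q r u v) u =
      (q * u ^ 2 + (r * q + p ^ 2 + v) * u + (v * (r + p) + p * r)) /
        (q * u ^ 2 + (p * q + v) * u + q * (v + r)) := by
  have h : q * u + v ≠ 0 := by positivity
  unfold ratMap
  rw [← mul_div_mul_right _ _ h]
  congr 1 <;> field_simp <;> ring

/-- Substituting the map into its first argument produces a map decreasing in the first variable. -/
lemma ratMap_ratMap_antitone_left (hq : 0 < q) (hpq : q < p) (hr : 0 ≤ r) {u u' v : ℝ}
    (hu : 0 < u) (huu' : u ≤ u') (hv : 0 < v) (hqr : q * r ≤ (p - q) * v) :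
    ratMap p q r (ratMap p q r u' v) u' ≤ ratMap p q r (ratMap p q r u v) u := by
  have hu' := hu.trans_le huu'
  have hp := hq.trans hpq
  rw [ratMap_ratMap_eq hq hu hv, ratMap_ratMap_eq hq hu' hv,
    div_le_div_iff₀ (by positivity) (by positivity)]
  have hd := sub_pos.2 hpq
  have h1 : 0 ≤ q * (r * q + p * (p - q)) * (u * u') := by positivity
  have h2 : 0 ≤ q * (v * (r + (p - q)) + r * (p - q)) * (u + u') := by positivity
  have h3 : 0 ≤ v ^ 2 * (r + (p - q)) := by positivity
  have h4 : 0 ≤ r * (q + 1) * ((p - q) * v - q * r) :=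
    mul_nonneg (by positivity) (sub_nonneg.2 hqr)
  have h5 : 0 ≤ q * r ^ 2 := by positivity
  have key := mul_nonneg (sub_nonneg.2 huu')
    (add_nonneg (add_nonneg (add_nonneg h1 h2) h3) (add_nonneg h4 h5))
  linear_combination key

lemma ratMap_ratMap_antitone_right (hq : 0 < q) (hpq : q < p) (hr : 0 ≤ r) {u v v' : ℝ}
    (hu : 0 < u) (hv : 0 < v) (hvv' : v ≤ v') (hqr : q * r ≤ (p - q) * u) :
    ratMap p q r (ratMap p q r u v') u ≤ ratMap p q r (ratMap p q r u v) u := by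
  have hv' := hv.trans_le hvv'
  refine ratMap_le_ratMap_left hq (ratMap_pos hq hpq hr hu hv') ?_ hu hqr
  unfold ratMap
  rw [div_le_div_iff₀ (by positivity) (by positivity)]
  have h : 0 ≤ (v' - v) * ((p - q) * u + r) :=
    mul_nonneg (sub_nonneg.2 hvv') (add_nonneg (mul_pos (sub_pos.2 hpq) hu).le hr)
  linear_combination h

/-- The diagonal map `t ↦ f(f(t, t), t)` has no two-cycle of positive reals. -/
lemma ratMap_no_two_cycle (hq : 0 < q) (hpq : q < p) (hr : 0 ≤ r) (hextra : r ≤ p ^ 2 * q - p)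
    {m M : ℝ} (hm : 0 < m) (hM : 0 < M)
    (h1 : ratMap p q r (ratMap p q r m m) m = M)
    (h2 : ratMap p q r (ratMap p q r M M) M = m) : m = M := by
  have hp := hq.trans hpq
  rw [ratMap_ratMap_eq hq hm hm, div_eq_iff (by positivity)] at h1
  rw [ratMap_ratMap_eq hq hM hM, div_eq_iff (by positivity)] at h2
  by_contra hne
  have hprod : (q + 1) * (m * M) =
      (q + 1) * (m + M) + (r * (q + 1) + p * (p + 1)) + q * r := by
    refine mul_left_cancel₀ (sub_ne_zero.2 hne) ?_
    linear_combination h2 - h1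
  have hsum : (q * (p + 1) + (q + 1)) * (m * M) + q * r * (m + M) = p * r := by
    linear_combination (-1 / 2) * (h1 + h2) - (m + M) / 2 * hprod
  have hlow : p * (p + 1) + r * (q + 1) ≤ (q + 1) * (m * M) := by
    rw [hprod]
    have : 0 ≤ (q + 1) * (m + M) + q * r := by positivity
    linarith
  have hle : (q * (p + 1) + (q + 1)) * (m * M) ≤ p * r := by
    have : 0 ≤ q * r * (m + M) := by positivity
    linarith
  have h3 := mul_le_mul_of_nonneg_left hlow
    (by positivity : 0 ≤ q * (p + 1) + (q + 1))
  have h4 := mul_le_mul_of_nonneg_left hle (by positivity : 0 ≤ q + 1)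
  have h5 := mul_le_mul_of_nonneg_left hextra hp.le
  have h6 : 0 < (2 * q + 1) * (p * (p + 1) + r * (q + 1)) + p * q * p + p * q * (r * q) + p ^ 2 := by
    positivity
  linarith

lemma eq_of_ratMap_self (hq : 0 < q) (hpq : q < p) (hr : 0 ≤ r) {L : ℝ} (hL : 0 < L)
    (h : ratMap p q r L L = L) :
    L = (p + 1 + Real.sqrt ((p + 1) ^ 2 + 4 * r * (q + 1))) / (2 * (q + 1)) := by
  have hp := hq.trans hpq
  unfold ratMap at h
  rw [div_eq_iff (by positivity)] at h
  have hlin : 0 ≤ 2 * (q + 1) * L - (p + 1) := by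
    refine le_of_mul_le_mul_right ?_ hL
    have : 0 ≤ (q + 1) * L ^ 2 := by positivity
    nlinarith
  have hs : (p + 1) ^ 2 + 4 * r * (q + 1) = (2 * (q + 1) * L - (p + 1)) ^ 2 := by
    linear_combination 4 * (q + 1) * h
  rw [hs, Real.sqrt_sq hlin, eq_div_iff (by positivity)]
  ring

lemma tendsto_ratMap (hq : 0 < q) {ι : Type*} {l : Filter ι} {u v : ι → ℝ} {x y : ℝ}
    (hx : 0 < x) (hy : 0 < y) (hu : Tendsto u l (𝓝 x)) (hv : Tendsto v l (𝓝 y)) :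
    Tendsto (fun i => ratMap p q r (u i) (v i)) l (𝓝 (ratMap p q r x y)) :=
  (((hu.const_mul p).const_add r).add hv).div ((hu.const_mul q).add hv) (by positivity)

end ratMap

/-- Lemma: under the hypotheses of the proposition, if moreover `r ≤ p²q − p`, every solution starting in the invariant interval converges to the equilibrium.
Here `x 0` plays the role of `x_{-1}` and `x 1` of `x_0`. -/
theorem stmt_9 (p q r : ℝ) (hq : 0 < q) (hpq : q < p) (hr : 0 ≤ r)
    (hcond : q * r / (p - q) < p / q)
    (hextra : r ≤ p ^ 2 * q - p)
    (mt Mt : ℝ) (hmt : q * r / (p - q) < mt) (hmM : mt ≤ Mt) (hMt : Mt < p / q)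
    (hinv : ∀ x ∈ Icc mt Mt, ∀ y ∈ Icc mt Mt,
      (r + p * x + y) / (q * x + y) ∈ Icc mt Mt)
    (x : ℕ → ℝ) (hx0 : x 0 ∈ Icc mt Mt) (hx1 : x 1 ∈ Icc mt Mt)
    (hrec : ∀ n : ℕ, x (n + 2) = (r + p * x (n + 1) + x n) / (q * x (n + 1) + x n)) :
    Tendsto x atTop
      (nhds ((p + 1 + Real.sqrt ((p + 1) ^ 2 + 4 * r * (q + 1))) / (2 * (q + 1)))) := by
  have hd : 0 < p - q := sub_pos.2 hpq
  have hmt0 : 0 < mt := lt_of_le_of_lt (by positivity) hmt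
  have hpos : ∀ t ∈ Icc mt Mt, 0 < t := fun t ht => hmt0.trans_le ht.1
  have hqr : ∀ t ∈ Icc mt Mt, q * r ≤ (p - q) * t := fun t ht => by
    have := (div_lt_iff₀ hd).1 (hmt.trans_le ht.1)
    linarith
  have hmaps : ∀ u ∈ Icc mt Mt, ∀ v ∈ Icc mt Mt, ratMap p q r u v ∈ Icc mt Mt := hinv
  have hrec' : ∀ n, x (n + 2) = ratMap p q r (x (n + 1)) (x n) := hrec
  have hx : ∀ n, x n ∈ Icc mt Mt ∧ x (n + 1) ∈ Icc mt Mt := by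
    intro n
    induction n with
    | zero => exact ⟨hx0, hx1⟩
    | succ n ih => exact ⟨ih.2, hrec' n ▸ hmaps _ ih.2 _ ih.1⟩
  obtain ⟨L, hL, hlim⟩ := exists_tendsto_of_antitone_of_no_two_cycle
    (g := fun u v => ratMap p q r (ratMap p q r u v) u) hmM
    (fun u hu v hv => hmaps _ (hmaps u hu v hv) _ hu)
    (fun u hu u' hu' v hv v' hv' huu' hvv' =>
      (ratMap_ratMap_antitone_left hq hpq hr (hpos u hu) huu' (hpos v' hv') (hqr v' hv')).trans
        (ratMap_ratMap_antitone_right hq hpq hr (hpos u hu) (hpos v hv) hvv' (hqr u hu)))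
    (fun t ht =>
      have h0 := hpos t ht
      have hid : Tendsto id (𝓝[Icc mt Mt] t) (𝓝 t) := nhdsWithin_le_nhds
      tendsto_ratMap hq (ratMap_pos hq hpq hr h0 h0) h0 (tendsto_ratMap hq h0 h0 hid hid) hid)
    (fun m hm M hM => ratMap_no_two_cycle hq hpq hr hextra (hpos m hm) (hpos M hM))
    (fun n => (hx n).1)
    (fun n => by rw [hrec' (n + 1), hrec' n])
  have hL0 := hpos L hL
  have hfix : ratMap p q r L L = L :=
    tendsto_nhds_unique
      ((tendsto_ratMap hq hL0 hL0 ((tendsto_add_atTop_iff_nat 1).2 hlim) hlim).congr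
        fun n => (hrec' n).symm)
      ((tendsto_add_atTop_iff_nat 2).2 hlim)
  rwa [← eq_of_ratMap_self hq hpq hr hL0 hfix]
end
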